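/- There exist constants γ > 0, C > 0 and N₀ ∈ ℕ (depending only on fixed constants c₁, c₂, c₃, c₄ > 0) such that for all n ≥ N₀ the following holds. Let P be an n×n probability matrix with ER-type core–periphery structure, let r ∈ [n], and suppose: (i) |λ_r| ≥ c₁ n p*/√r and |λ_{r+1}| ≤ c₂ √(p* log n) (approximate low-rankness); (ii) ‖U‖_{2,∞} ≤ μ₀ √(r/n) for some μ₀ ≥ 1 (incoherence); (iii) p* ≥ c₃ · max{μ₀² r log n / n, μ₀² r² / n}; (iv) |λ₁/λ_r| ≤ c₄; and (v) h(n) ≥ C (μ₀ √(r (log n + r) p*) + μ₀² r √(p*)). Then, for a random adjacency matrix A generated from P, Algorithm 1 run with the correct N_𝒞 and rank r exactly identifies the core and periphery with probability at least 1 − (B(r)+2) n^{−γ}, where B(r) = 10·min{r, 1 + log₂|λ₁/λ_r|}. -/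

import Mathlib

open Matrix MeasureTheory ProbabilityTheory

noncomputable section





/-- Euclidean norm of the `i`-th row of a matrix. -/
def rowNorm {n m : ℕ} (M : Matrix (Fin n) (Fin m) ℝ) (i : Fin n) : ℝ :=
  Real.sqrt (∑ j, (M i j) ^ 2)

/-- Two-to-infinity norm: maximum Euclidean norm of the rows. -/
def twoInf {n m : ℕ} (M : Matrix (Fin n) (Fin m) ℝ) : ℝ :=
  ⨆ i, rowNorm M i

/-- Spectral norm of a square real matrix. -/
def specNorm {n : ℕ} (M : Matrix (Fin n) (Fin n) ℝ) : ℝ :=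
  ‖LinearMap.toContinuousLinearMap (Matrix.toEuclideanLin M)‖

/-- Frobenius norm. -/
def frobNorm {n : ℕ} (M : Matrix (Fin n) (Fin n) ℝ) : ℝ :=
  Real.sqrt (∑ i, ∑ j, (M i j) ^ 2)

/-- The centering matrix `H = I - (1/n) 11ᵗ`. -/
def centerH (n : ℕ) : Matrix (Fin n) (Fin n) ℝ :=
  1 - (n : ℝ)⁻¹ • Matrix.of (fun _ _ => (1 : ℝ))

/-- A probability matrix: symmetric, entries in `[0,1]`, zero diagonal. -/
def IsProbMatrix {n : ℕ} (P : Matrix (Fin n) (Fin n) ℝ) : Prop :=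
  P.IsSymm ∧ (∀ i j, 0 ≤ P i j) ∧ (∀ i j, P i j ≤ 1) ∧ (∀ i, P i i = 0)

/-- Maximum entry `p* = max_{i,j} P_ij`. -/
def pstar {n : ℕ} (P : Matrix (Fin n) (Fin n) ℝ) : ℝ := ⨆ i, ⨆ j, P i j

/-- Expected degree `d_i = Σ_j P_ij`. -/
def deg {n : ℕ} (P : Matrix (Fin n) (Fin n) ℝ) (i : Fin n) : ℝ := ∑ j, P i j

open Classical in
/-- ER-type periphery set. -/
def peripheryER {n : ℕ} (P : Matrix (Fin n) (Fin n) ℝ) : Finset (Fin n) :=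
  Finset.univ.filter fun i => ∀ j k, j ≠ i → k ≠ i → P i j = P i k

/-- ER-type core set. -/
def coreER {n : ℕ} (P : Matrix (Fin n) (Fin n) ℝ) : Finset (Fin n) :=
  (peripheryER P)ᶜ

/-- `h(n) = min_{i ∈ core} ‖P_{i,*} H‖₂`. -/
def hSignal {n : ℕ} (P : Matrix (Fin n) (Fin n) ℝ) : ℝ :=
  ⨅ i : {i // i ∈ coreER P}, rowNorm (P * centerH n) i.1

open Classical in
/-- Configuration-type periphery set. -/
def peripheryConfig {n : ℕ} (P : Matrix (Fin n) (Fin n) ℝ) : Finset (Fin n) :=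
  Finset.univ.filter fun i => ∀ j, j ≠ i → P i j = deg P i * deg P j / ∑ k, deg P k

/-- Configuration-type core set. -/
def coreConfig {n : ℕ} (P : Matrix (Fin n) (Fin n) ℝ) : Finset (Fin n) :=
  (peripheryConfig P)ᶜ

/-- Diagonal matrix with entries `(d i)⁻¹`, i.e. `D⁻¹`. -/
def degInv {n : ℕ} (d : Fin n → ℝ) : Matrix (Fin n) (Fin n) ℝ :=
  Matrix.diagonal fun i => (d i)⁻¹

/-- `h'(n) = min_{i ∈ core} ‖P_{i,*} D⁻¹ H‖₂`. -/
def hSignal' {n : ℕ} (P : Matrix (Fin n) (Fin n) ℝ) : ℝ :=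
  ⨅ i : {i // i ∈ coreConfig P}, rowNorm (P * degInv (deg P) * centerH n) i.1

/-- Eigendecomposition `P = V Λ Vᵗ` with eigenvalues ordered by decreasing absolute value. -/
def IsEigenDecomp {n : ℕ} (P V : Matrix (Fin n) (Fin n) ℝ) (lam : Fin n → ℝ) : Prop :=
  V * Vᵀ = 1 ∧ P = V * Matrix.diagonal lam * Vᵀ ∧
    ∀ i j : Fin n, i ≤ j → |lam j| ≤ |lam i|

/-- `T` is a rank-`r` spectral truncation of `A`: it retains, from an eigendecomposition of `A`
ordered by decreasing absolute value, the `r` leading eigenvalues and their eigenvectors. -/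
def IsSpecTrunc {n : ℕ} (r : ℕ) (A T : Matrix (Fin n) (Fin n) ℝ) : Prop :=
  ∃ (W : Matrix (Fin n) (Fin n) ℝ) (mu : Fin n → ℝ), IsEigenDecomp A W mu ∧
    T = W * Matrix.diagonal (fun i : Fin n => if (i : ℕ) < r then mu i else 0) * Wᵀ

/-- `U`: the `n × r` matrix of the top-`r` eigenvectors (first `r` columns of `V`). -/
def topEig {n : ℕ} (V : Matrix (Fin n) (Fin n) ℝ) (r : ℕ) (h : r ≤ n) :
    Matrix (Fin n) (Fin r) ℝ :=
  fun i k => V i (Fin.castLE h k)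

/-- `A` is a random adjacency matrix generated from `P`: symmetric, zero diagonal, 0/1 entries,
with `A_ij ~ Bernoulli(P_ij)` independently over pairs `i < j`. -/
def IsAdjacencyModel {n : ℕ} {Ω : Type*} [MeasurableSpace Ω] (μ : Measure Ω)
    (P : Matrix (Fin n) (Fin n) ℝ) (A : Ω → Matrix (Fin n) (Fin n) ℝ) : Prop :=
  (∀ ω, (A ω).IsSymm) ∧ (∀ ω i, A ω i i = 0) ∧
  (∀ ω i j, A ω i j = 0 ∨ A ω i j = 1) ∧
  (∀ i j : Fin n, Measurable fun ω => A ω i j) ∧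
  (∀ i j : Fin n, i < j → μ {ω | A ω i j = 1} = ENNReal.ofReal (P i j)) ∧
  iIndepFun
    (fun (p : {q : Fin n × Fin n // q.1 < q.2}) => fun ω => A ω p.1.1 p.1.2) μ

/-- Exact recovery: every core score strictly exceeds every non-core score, so the
`N_core` indices with largest scores are exactly the core. -/
def ExactRecovery {n : ℕ} (S : Fin n → ℝ) (core : Finset (Fin n)) : Prop :=
  ∀ i ∈ core, ∀ j ∉ core, S j < S i

/-- `B(r) = 10 min{r, 1 + log₂ ratio}` where `ratio = |λ₁/λ_r|`. -/
def Bconst (ratio : ℝ) (r : ℕ) : ℝ := 10 * min (r : ℝ) (1 + Real.logb 2 ratio)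



/-- Matrix as an operator on Euclidean space. -/
def cl {n : ℕ} (M : Matrix (Fin n) (Fin n) ℝ) :
    EuclideanSpace ℝ (Fin n) →L[ℝ] EuclideanSpace ℝ (Fin n) :=
  Matrix.toEuclideanCLM (n := Fin n) (𝕜 := ℝ) M

lemma cl_mul {n : ℕ} (M N : Matrix (Fin n) (Fin n) ℝ) : cl (M * N) = cl M * cl N := by
  simp [cl]

lemma cl_sub {n : ℕ} (M N : Matrix (Fin n) (Fin n) ℝ) : cl (M - N) = cl M - cl N := by
  simp [cl]

lemma cl_one {n : ℕ} : cl (1 : Matrix (Fin n) (Fin n) ℝ) = 1 := by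
  simp [cl]

lemma cl_apply {n : ℕ} (M : Matrix (Fin n) (Fin n) ℝ) (x : EuclideanSpace ℝ (Fin n)) (i : Fin n) :
    cl M x i = ∑ j, M i j * x j := by
  rfl

lemma cl_inj {n : ℕ} {M N : Matrix (Fin n) (Fin n) ℝ} (h : cl M = cl N) : M = N :=
  (Matrix.toEuclideanCLM (n := Fin n) (𝕜 := ℝ)).injective h

lemma nsq {n : ℕ} (x : EuclideanSpace ℝ (Fin n)) : ‖x‖ ^ 2 = ∑ i, (x i) ^ 2 := by
  simp [EuclideanSpace.norm_sq_eq]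

lemma nsq_mul {n : ℕ} (W : Matrix (Fin n) (Fin n) ℝ) (hW : Wᵀ * W = 1)
    (x : EuclideanSpace ℝ (Fin n)) : ‖cl W x‖ ^ 2 = ‖x‖ ^ 2 := by
  have h : ∀ y : EuclideanSpace ℝ (Fin n), ‖y‖^2 = y.ofLp ⬝ᵥ y.ofLp := by
    intro y; rw [nsq]; simp [dotProduct, sq]
  rw [h, h]
  have h2 : (cl W x).ofLp = W *ᵥ x.ofLp := rfl
  rw [h2, Matrix.dotProduct_mulVec, Matrix.vecMul_mulVec, ← Matrix.dotProduct_mulVec, hW]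
  simp

/-- The coordinates in the eigenbasis. -/
def co {n : ℕ} (W : Matrix (Fin n) (Fin n) ℝ) (x : EuclideanSpace ℝ (Fin n)) (k : Fin n) : ℝ :=
  ∑ j, W j k * x j

lemma co_eq {n : ℕ} (W : Matrix (Fin n) (Fin n) ℝ) (x : EuclideanSpace ℝ (Fin n)) (k : Fin n) :
    co W x k = cl Wᵀ x k := by
  rw [cl_apply]; rfl

lemma nsq_conj {n : ℕ} (W : Matrix (Fin n) (Fin n) ℝ) (hW : W * Wᵀ = 1) (d : Fin n → ℝ)
    (x : EuclideanSpace ℝ (Fin n)) :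
    ‖cl (W * diagonal d * Wᵀ) x‖ ^ 2 = ∑ k, (d k * co W x k) ^ 2 := by
  have hW' : Wᵀ * W = 1 := mul_eq_one_comm.mp hW
  rw [mul_assoc, cl_mul]
  change ‖cl W (cl (diagonal d * Wᵀ) x)‖ ^ 2 = _
  rw [nsq_mul W hW', nsq, cl_mul]
  refine Finset.sum_congr rfl fun k _ => ?_
  change (cl (diagonal d) (cl Wᵀ x) k) ^ 2 = _
  rw [cl_apply, co_eq]
  simp [diagonal_apply]

lemma nsq_co {n : ℕ} (W : Matrix (Fin n) (Fin n) ℝ) (hW : W * Wᵀ = 1)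
    (x : EuclideanSpace ℝ (Fin n)) : ‖x‖ ^ 2 = ∑ k, (co W x k) ^ 2 := by
  have := nsq_mul Wᵀ (by simpa using hW) x
  rw [← this, nsq]
  simp [co_eq]

lemma conj_norm_le {n : ℕ} (W : Matrix (Fin n) (Fin n) ℝ) (hW : W * Wᵀ = 1) (d : Fin n → ℝ)
    (b : ℝ) (hb : ∀ k, |d k| ≤ b) (hb0 : 0 ≤ b) : ‖cl (W * diagonal d * Wᵀ)‖ ≤ b := by
  refine ContinuousLinearMap.opNorm_le_bound _ hb0 fun x => ?_
  refine abs_le_of_sq_le_sq' ?_ (by positivity) |>.2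
  rw [nsq_conj W hW, mul_pow, nsq_co W hW, Finset.mul_sum]
  refine Finset.sum_le_sum fun k _ => ?_
  rw [mul_pow]
  gcongr ?_ * _
  exact sq_le_sq.mpr (by rw [abs_of_nonneg hb0]; exact hb k)

/-- Top-`r` spectral projection. -/
def proj {n : ℕ} (W : Matrix (Fin n) (Fin n) ℝ) (r : ℕ) : Matrix (Fin n) (Fin n) ℝ :=
  W * Matrix.diagonal (fun i : Fin n => if (i : ℕ) < r then (1 : ℝ) else 0) * Wᵀ

lemma wconj_mul {n : ℕ} (W : Matrix (Fin n) (Fin n) ℝ) (hW : W * Wᵀ = 1) (d d' : Fin n → ℝ) :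
    (W * diagonal d * Wᵀ) * (W * diagonal d' * Wᵀ) = W * diagonal (fun i => d i * d' i) * Wᵀ := by
  have hW' : Wᵀ * W = 1 := mul_eq_one_comm.mp hW
  calc _ = W * diagonal d * (Wᵀ * W) * diagonal d' * Wᵀ := by simp only [mul_assoc]
    _ = _ := by rw [hW', mul_one, mul_assoc W, diagonal_mul_diagonal]

lemma one_sub_conj {n : ℕ} (W : Matrix (Fin n) (Fin n) ℝ) (hW : W * Wᵀ = 1) (d : Fin n → ℝ) :
    1 - (W * diagonal d * Wᵀ) = W * diagonal (fun i => 1 - d i) * Wᵀ := by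
  have : (diagonal (fun i => 1 - d i) : Matrix (Fin n) (Fin n) ℝ) = 1 - diagonal d := by
    rw [← diagonal_one, diagonal_sub]
  rw [this, mul_sub, sub_mul, mul_one, hW]

/-- Abstract properties of a spectral projection `Q` for the operator `A`. -/
structure SpecProj {n : ℕ} (A Q : EuclideanSpace ℝ (Fin n) →L[ℝ] EuclideanSpace ℝ (Fin n))
    (a b : ℝ) : Prop where
  comm : A * Q = Q * A
  idem : Q * Q = Q
  nQ : ‖Q‖ ≤ 1
  nQ' : ‖1 - Q‖ ≤ 1
  lower : ∀ x, a * ‖Q x‖ ≤ ‖A (Q x)‖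
  upper : ‖A * (1 - Q)‖ ≤ b

lemma specProj_of {n : ℕ} {A W : Matrix (Fin n) (Fin n) ℝ} {mu : Fin n → ℝ}
    (hA : W * Wᵀ = 1 ∧ A = W * Matrix.diagonal mu * Wᵀ ∧
      ∀ i j : Fin n, i ≤ j → |mu j| ≤ |mu i|) (r : ℕ) (hr : 1 ≤ r) (hrn : r < n) :
    SpecProj (cl A) (cl (proj W r)) |mu ⟨r - 1, by omega⟩| |mu ⟨r, hrn⟩| := by
  obtain ⟨hW, rfl, hs⟩ := hA
  constructor
  · rw [← cl_mul, ← cl_mul, proj, wconj_mul W hW, wconj_mul W hW]; simp [mul_comm]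
  · rw [← cl_mul, proj, wconj_mul W hW]
    congr 4; ext i; split_ifs <;> simp
  · refine conj_norm_le W hW _ _ (fun k => ?_) zero_le_one
    split_ifs <;> simp
  · rw [← cl_one, ← cl_sub, proj, one_sub_conj W hW]
    refine conj_norm_le W hW _ _ (fun k => ?_) zero_le_one
    split_ifs <;> simp
  · intro x
    change _ ≤ ‖(cl (W * diagonal mu * Wᵀ) * cl (proj W r)) x‖
    rw [← cl_mul, proj, wconj_mul W hW]
    refine abs_le_of_sq_le_sq' ?_ (by positivity) |>.2
    rw [mul_pow, nsq_conj W hW, nsq_conj W hW, Finset.mul_sum]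
    refine Finset.sum_le_sum fun k _ => ?_
    split_ifs with h
    · simp only [mul_pow, sq_abs, one_pow, one_mul, mul_one]
      gcongr ?_ * _
      exact sq_le_sq.mpr (hs _ _ (by rw [Fin.le_def]; simp; omega))
    · simp
  · rw [← cl_one, ← cl_sub, ← cl_mul, proj, one_sub_conj W hW, wconj_mul W hW]
    refine conj_norm_le W hW _ _ (fun k => ?_) (abs_nonneg _)
    split_ifs with h
    · simp
    · simpa using hs _ _ (by rw [Fin.le_def]; simp; omega)

/-- Weyl inequality for singular values. -/
lemma weyl {n : ℕ} {A W P V : Matrix (Fin n) (Fin n) ℝ} {mu lam : Fin n → ℝ}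
    (hA : W * Wᵀ = 1 ∧ A = W * Matrix.diagonal mu * Wᵀ ∧
      ∀ i j : Fin n, i ≤ j → |mu j| ≤ |mu i|)
    (hP : V * Vᵀ = 1 ∧ P = V * Matrix.diagonal lam * Vᵀ ∧
      ∀ i j : Fin n, i ≤ j → |lam j| ≤ |lam i|) (k : Fin n) :
    |mu k| ≤ |lam k| + ‖cl A - cl P‖ := by
  obtain ⟨hW, hA, hs⟩ := hA
  obtain ⟨hV, hP, hs'⟩ := hP
  let F : EuclideanSpace ℝ (Fin n) →ₗ[ℝ] ({i : Fin n // i ≠ k} → ℝ) :=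
    { toFun := fun x i => if k < i.1 then co W x i.1 else co V x i.1
      map_add' := by
        intro x y; ext i; simp only [Pi.add_apply]
        split_ifs <;> simp [co, mul_add, Finset.sum_add_distrib]
      map_smul' := by
        intro c x; ext i; simp only [Pi.smul_apply, RingHom.id_apply]
        split_ifs <;> simp [co, Finset.mul_sum, mul_left_comm] }
  have hker : LinearMap.ker F ≠ ⊥ := by
    apply LinearMap.ker_ne_bot_of_finrank_lt
    have hn : 0 < n := k.pos
    simp [Fintype.card_subtype_compl]
    exact hn
  obtain ⟨x, hx, hx0⟩ := (Submodule.ne_bot_iff _).mp hker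
  have hF : ∀ i : Fin n, (k < i → co W x i = 0) ∧ (i < k → co V x i = 0) := by
    intro i
    constructor
    · intro h
      have := congrFun (LinearMap.mem_ker.mp hx) ⟨i, h.ne'⟩
      simpa [F, h] using this
    · intro h
      have := congrFun (LinearMap.mem_ker.mp hx) ⟨i, h.ne⟩
      simpa [F, h.not_gt] using this
  have h1 : |mu k| * ‖x‖ ≤ ‖cl A x‖ := by
    refine abs_le_of_sq_le_sq' ?_ (by positivity) |>.2
    rw [hA, mul_pow, nsq_conj W hW, nsq_co W hW, Finset.mul_sum]
    refine Finset.sum_le_sum fun i _ => ?_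
    rw [mul_pow]
    rcases lt_or_ge k i with h | h
    · simp [(hF i).1 h]
    · gcongr ?_ * _
      rw [sq_abs]; exact sq_le_sq.mpr (hs _ _ h)
  have h2 : ‖cl P x‖ ≤ |lam k| * ‖x‖ := by
    refine abs_le_of_sq_le_sq' ?_ (by positivity) |>.2
    rw [hP, mul_pow, nsq_conj V hV, nsq_co V hV, Finset.mul_sum]
    refine Finset.sum_le_sum fun i _ => ?_
    rw [mul_pow]
    rcases lt_or_ge i k with h | h
    · simp [(hF i).2 h]
    · gcongr ?_ * _
      rw [sq_abs]; exact sq_le_sq.mpr (hs' _ _ h)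
  have h3 : ‖cl A x‖ ≤ ‖cl P x‖ + ‖cl A - cl P‖ * ‖x‖ := by
    have := (cl A - cl P).le_opNorm x
    rw [_root_.sub_apply] at this
    have h4 := norm_sub_norm_le (cl A x) (cl P x)
    linarith
  have hxp : 0 < ‖x‖ := norm_pos_iff.mpr hx0
  have : |mu k| * ‖x‖ ≤ (|lam k| + ‖cl A - cl P‖) * ‖x‖ := by linarith
  exact le_of_mul_le_mul_right this hxp

/-- Davis-Kahan type inequality. -/
lemma davis_kahan {n : ℕ}
    {A B Q Q' : EuclideanSpace ℝ (Fin n) →L[ℝ] EuclideanSpace ℝ (Fin n)} {a b a' b' : ℝ}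
    (hQ : SpecProj A Q a b') (hQ' : SpecProj B Q' a' b) (ha : 0 ≤ a) :
    (a - b) * ‖Q * (1 - Q')‖ ≤ ‖Q * (A - B) * (1 - Q')‖ := by
  set M := Q * (1 - Q') with hM
  have hid : A * M - M * B = Q * (A - B) * (1 - Q') := by
    have h1 : (1 - Q') * B = B * (1 - Q') := by rw [sub_mul, mul_sub, hQ'.comm]; simp
    rw [hM, mul_assoc Q, h1, ← mul_assoc A, hQ.comm]
    simp only [mul_sub, sub_mul, mul_assoc, mul_one]
    abel
  have hlow : a * ‖M‖ ≤ ‖A * M‖ := by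
    rcases ha.eq_or_lt with h | h
    · rw [← h]; simp
    · rw [← le_div_iff₀' h]
      refine ContinuousLinearMap.opNorm_le_bound _ (by positivity) fun x => ?_
      have h2 := hQ.lower ((1 - Q') x)
      have h3 := (A * M).le_opNorm x
      have h4 : M x = Q ((1 - Q') x) := rfl
      have h5 : (A * M) x = A (Q ((1 - Q') x)) := rfl
      rw [← h5] at h2
      rw [h4, div_mul_eq_mul_div, le_div_iff₀' h]
      linarith
  have hup : ‖M * B‖ ≤ ‖M‖ * b := by
    have h1 : M * B = M * (B * (1 - Q')) := by
      have h1 : B * (1 - Q') = (1 - Q') * B := by rw [sub_mul, mul_sub, hQ'.comm]; simp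
      have h2 : (1 - Q') * (1 - Q') = 1 - Q' := by
        have := hQ'.idem
        rw [mul_sub, sub_mul, sub_mul, this]; simp
      rw [h1, hM, ← mul_assoc, mul_assoc Q (1 - Q') (1 - Q'), h2]
    rw [h1]
    exact (norm_mul_le _ _).trans (mul_le_mul_of_nonneg_left hQ'.upper (norm_nonneg _))
  have h3 := norm_sub_norm_le (A * M) (M * B)
  rw [hid] at h3
  nlinarith


/-- The edge traversed at step `t` of the walk `w`. -/
def wedge {α : Type*} {N : ℕ} (w : Fin (N + 1) → α) (t : Fin N) : Sym2 α :=
  s(w t.castSucc, w t.succ)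

/-- Closed walks without loops for which each edge is traversed at least twice. -/
def GoodW {α : Type*} {N : ℕ} (w : Fin (N + 1) → α) : Prop :=
  w 0 = w (Fin.last N) ∧ (∀ t : Fin N, w t.castSucc ≠ w t.succ) ∧
    ∀ t, ∃ s, s ≠ t ∧ wedge w s = wedge w t

lemma pow_walk {n : ℕ} (M : Matrix (Fin n) (Fin n) ℝ) (N : ℕ) (i j : Fin n) :
    (M ^ N) i j = ∑ w : Fin (N + 1) → Fin n,
      if w 0 = i ∧ w (Fin.last N) = j then ∏ t : Fin N, M (w t.castSucc) (w t.succ) else 0 := by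
  induction N generalizing i with
  | zero =>
    rw [← (Equiv.funUnique (Fin 1) (Fin n)).symm.sum_comp]
    simp only [pow_zero, Matrix.one_apply, Fin.last_zero, Finset.univ_eq_empty, Finset.prod_empty]
    have : ∀ x : Fin n, (Equiv.funUnique (Fin 1) (Fin n)).symm x 0 = x := fun x => rfl
    simp only [this]
    by_cases h : i = j
    · subst h; simp
    · rw [if_neg h]; symm
      apply Finset.sum_eq_zero
      intro x _
      rw [if_neg]; rintro ⟨rfl, rfl⟩; exact h rfl
  | succ N ih =>
    rw [pow_succ', Matrix.mul_apply]
    rw [← (Fin.consEquiv (fun _ : Fin (N + 2) => Fin n)).sum_comp, Fintype.sum_prod_type]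
    have h0 : ∀ (x : Fin n) (w : Fin (N + 1) → Fin n),
        (if (Fin.consEquiv (fun _ : Fin (N + 2) => Fin n)) (x, w) 0 = i ∧
          (Fin.consEquiv (fun _ : Fin (N + 2) => Fin n)) (x, w) (Fin.last (N + 1)) = j then
          ∏ t : Fin (N + 1), M ((Fin.consEquiv (fun _ : Fin (N + 2) => Fin n)) (x, w) t.castSucc)
            ((Fin.consEquiv (fun _ : Fin (N + 2) => Fin n)) (x, w) t.succ) else 0) =
        if x = i then (if w (Fin.last N) = j then
          M i (w 0) * ∏ t : Fin N, M (w t.castSucc) (w t.succ) else 0) else 0 := by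
      intro x w
      have h1 : (Fin.consEquiv (fun _ : Fin (N + 2) => Fin n)) (x, w) = Fin.cons x w := rfl
      rw [h1, Fin.prod_univ_succ]
      simp only [Fin.cons_zero, Fin.castSucc_zero, Fin.cons_succ, ← Fin.succ_last]
      by_cases hx : x = i
      · subst hx
        simp only [true_and, if_true]
        congr 1
      · simp [hx]
    simp only [h0]
    rw [Finset.sum_comm]
    simp only [Finset.sum_ite_eq', Finset.mem_univ, if_true]
    simp only [ih, Finset.mul_sum]
    rw [Finset.sum_comm]
    refine Finset.sum_congr rfl fun w _ => ?_
    rw [Finset.sum_eq_single (w 0)]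
    · by_cases hj : w (Fin.last N) = j <;> simp [hj]
    · intro b _ hb
      rw [if_neg (fun h => hb h.1.symm), mul_zero]
    · simp

lemma trace_walk {n : ℕ} (M : Matrix (Fin n) (Fin n) ℝ) (N : ℕ) :
    trace (M ^ N) = ∑ w : Fin (N + 1) → Fin n,
      if w 0 = w (Fin.last N) then ∏ t : Fin N, M (w t.castSucc) (w t.succ) else 0 := by
  simp only [trace, diag_apply, pow_walk]
  rw [Finset.sum_comm]
  refine Finset.sum_congr rfl fun w _ => ?_
  rw [Finset.sum_eq_single (w 0)]
  · simp [eq_comm]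
  · intro b _ hb
    rw [if_neg (fun h => hb h.1.symm)]
  · simp

open Classical in
lemma verts_le {α : Type*} {N : ℕ} (w : Fin (N + 1) → α) :
    (Finset.univ.image w).card ≤ (Finset.univ.image (wedge w)).card + 1 := by
  induction N with
  | zero =>
    refine (Finset.card_image_le).trans ?_
    simp
  | succ N ih =>
    have h1 : Finset.univ.image w = insert (w 0) (Finset.univ.image (fun t : Fin (N + 1) => w t.succ)) := by
      ext x; simp [Fin.exists_fin_succ, eq_comm]
    have h2 : Finset.univ.image (wedge w) = insert s(w 0, w 1)
        (Finset.univ.image (wedge (fun t : Fin (N + 1) => w t.succ))) := by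
      ext x
      simp only [Finset.mem_image, Finset.mem_univ, true_and, Finset.mem_insert, Fin.exists_fin_succ]
      simp [wedge, eq_comm]
    have ih' := ih (fun t : Fin (N + 1) => w t.succ)
    rw [h1, h2]
    by_cases h : w 0 ∈ Finset.univ.image (fun t : Fin (N + 1) => w t.succ)
    · rw [Finset.insert_eq_of_mem h]
      refine ih'.trans ?_
      gcongr
      exact Finset.subset_insert _ _
    · have h3 : s(w 0, w 1) ∉ Finset.univ.image (wedge (fun t : Fin (N + 1) => w t.succ)) := by
        intro hc
        simp only [Finset.mem_image, Finset.mem_univ, true_and, wedge] at hc h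
        obtain ⟨t, ht⟩ := hc
        have : w 0 ∈ s(w t.castSucc.succ, w t.succ.succ) := by rw [ht]; simp
        rw [Sym2.mem_iff] at this
        rcases this with h' | h'
        · exact h ⟨_, h'.symm⟩
        · exact h ⟨_, h'.symm⟩
      rw [Finset.card_insert_of_notMem h, Finset.card_insert_of_notMem h3]
      omega

open Classical in
lemma edges_le {α : Type*} {N : ℕ} (w : Fin (N + 1) → α) (hw : GoodW w) :
    2 * (Finset.univ.image (wedge w)).card ≤ N := by
  have h := Finset.card_eq_sum_card_image (wedge w) (Finset.univ : Finset (Fin N))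
  have h2 : ∑ b ∈ Finset.univ.image (wedge w), 2 ≤
      ∑ b ∈ Finset.univ.image (wedge w), (Finset.univ.filter fun x => wedge w x = b).card := by
    refine Finset.sum_le_sum fun b hb => ?_
    obtain ⟨t, -, rfl⟩ := Finset.mem_image.mp hb
    obtain ⟨s, hs, hst⟩ := hw.2.2 t
    have : 1 < (Finset.univ.filter fun x => wedge w x = wedge w t).card := by
      rw [Finset.one_lt_card]
      exact ⟨s, by simp [hst], t, by simp, hs⟩
    exact this
  rw [← h] at h2
  simp at h2
  omega

/-- Same coincidence pattern. -/
def SameK {ι α β : Type*} (w : ι → α) (w' : ι → β) : Prop := ∀ s t, w s = w t ↔ w' s = w' t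

lemma SameK.symm {ι α β : Type*} {w : ι → α} {w' : ι → β} (h : SameK w w') : SameK w' w :=
  fun s t => (h s t).symm

lemma SameK.wedge_iff {α β : Type*} {N : ℕ} {w : Fin (N + 1) → α} {w' : Fin (N + 1) → β}
    (h : SameK w w') (s t : Fin N) : wedge w s = wedge w t ↔ wedge w' s = wedge w' t := by
  simp only [wedge, Sym2.eq_iff, h _ _]

lemma SameK.good {α β : Type*} {N : ℕ} {w : Fin (N + 1) → α} {w' : Fin (N + 1) → β}
    (h : SameK w w') (hw : GoodW w) : GoodW w' := by
  refine ⟨(h _ _).1 hw.1, fun t ht => hw.2.1 t ((h _ _).2 ht), fun t => ?_⟩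
  obtain ⟨s, hs, hst⟩ := hw.2.2 t
  exact ⟨s, hs, (h.wedge_iff s t).1 hst⟩

open Classical in
/-- Number of distinct vertices visited. -/
def nV {ι α : Type*} [Fintype ι] (w : ι → α) : ℕ := (Finset.univ.image w).card

open Classical in
lemma nV_eq {ι α : Type*} [Fintype ι] (w : ι → α) : nV w = Fintype.card (Set.range w) := by
  rw [nV, ← Set.toFinset_card]; congr 1; ext; simp

open Classical in
lemma fibre_card {ι α β : Type*} [Fintype ι] [DecidableEq ι] [Fintype β] (w : ι → α) :
    (Finset.univ.filter fun w' : ι → β => SameK w w').card =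
      (Fintype.card β).descFactorial (nV w) := by
  rw [nV_eq, ← Fintype.card_embedding_eq, ← Fintype.card_subtype]
  refine Fintype.card_congr ?_
  have hs : ∀ y, w (Set.rangeSplitting w y) = y.1 := fun y => Set.apply_rangeSplitting w y
  refine Equiv.ofBijective (fun x => ⟨fun y => x.1 (Set.rangeSplitting w y), ?_⟩) ⟨?_, ?_⟩
  · intro y z hyz
    have := (x.2 _ _).2 hyz
    rw [hs, hs] at this
    exact Subtype.ext this
  · intro x x' hx
    apply Subtype.ext
    funext i
    have h := DFunLike.congr_fun hx ⟨w i, i, rfl⟩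
    change x.1 (Set.rangeSplitting w ⟨w i, i, rfl⟩) =
      x'.1 (Set.rangeSplitting w ⟨w i, i, rfl⟩) at h
    have h2 := hs ⟨w i, i, rfl⟩
    rw [(x.2 _ _).1 h2, (x'.2 _ _).1 h2] at h
    exact h
  · intro f
    refine ⟨⟨fun i => f ⟨w i, i, rfl⟩, fun s t => ?_⟩, ?_⟩
    · constructor
      · intro h; simp [h]
      · intro h; exact congrArg Subtype.val (f.injective h)
    · apply DFunLike.ext
      intro y
      change f ⟨w (Set.rangeSplitting w y), _⟩ = f y
      exact congrArg f (Subtype.ext (hs y))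

open Classical in
lemma SameK.card_eq {ι α β : Type*} [Fintype ι] {w : ι → α} {w' : ι → β} (h : SameK w w') :
    nV w = nV w' := by
  rw [nV_eq, nV_eq]
  have h3 : Setoid.ker w = Setoid.ker w' := by
    ext s t; exact h s t
  have e1 := Setoid.quotientKerEquivRange w
  rw [h3] at e1
  exact Fintype.card_congr (e1.symm.trans (Setoid.quotientKerEquivRange w'))

lemma desc_upper (n v : ℕ) (hv : 1 ≤ v) (p : ℝ) (hp : 0 ≤ p) :
    (n.descFactorial v : ℝ) * p ^ (v - 1) ≤ n * (n * p) ^ (v - 1) := by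
  have h : (n.descFactorial v : ℝ) ≤ (n : ℝ) ^ v := by exact_mod_cast Nat.descFactorial_le_pow n v
  calc _ ≤ (n : ℝ) ^ v * p ^ (v - 1) := by gcongr
    _ = _ := by
      obtain ⟨u, rfl⟩ : ∃ u, v = u + 1 := ⟨v - 1, by omega⟩
      simp; ring

lemma desc_lower (R v k : ℕ) (hv : 1 ≤ v) (hvk : v - 1 ≤ k) (hk : k < R) :
    (R : ℝ) * ((R : ℝ) - k) ^ (v - 1) ≤ R.descFactorial v := by
  obtain ⟨u, rfl⟩ : ∃ u, v = u + 1 := ⟨v - 1, by omega⟩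
  obtain ⟨S, rfl⟩ : ∃ S, R = S + 1 := ⟨R - 1, by omega⟩
  simp only [Nat.add_sub_cancel] at *
  rw [Nat.succ_descFactorial_succ]
  have h := Nat.pow_sub_le_descFactorial S u
  have h2 : ((S + 1 : ℕ) : ℝ) - k = ((S + 1 - k : ℕ) : ℝ) := by
    rw [Nat.cast_sub (by omega)]
  rw [h2]
  have h3 : (S + 1 - k) ^ u ≤ (S + 1 - u) ^ u := Nat.pow_le_pow_left (by omega) _
  have h4 : (S + 1) * (S + 1 - k) ^ u ≤ (S + 1) * S.descFactorial u :=
    Nat.mul_le_mul_left _ (h3.trans h)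
  exact_mod_cast h4

open Classical in
lemma walk_compare (n R k : ℕ) (p : ℝ) (hp : 0 < p) (hn : 0 < n) (hkR : k < R)
    (hR : (n : ℝ) * p ≤ R - k) :
    ∑ w ∈ Finset.univ.filter (fun w : Fin (2 * k + 1) → Fin n => GoodW w),
      p ^ ((nV w) - 1) ≤
    n / R * (Finset.univ.filter (fun w : Fin (2 * k + 1) → Fin R => GoodW w)).card := by
  have hRpos : (0 : ℝ) < R := by exact_mod_cast (by omega : 0 < R)
  have hnpos : (0 : ℝ) < n := by exact_mod_cast hn
  have hv1 : ∀ {m : ℕ} (w : Fin (2 * k + 1) → Fin m), 1 ≤ (nV w) := by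
    intro m w; rw [nV]; exact Finset.card_pos.mpr (by simp)
  have hvk : ∀ {m : ℕ} (w : Fin (2 * k + 1) → Fin m), GoodW w →
      (nV w) - 1 ≤ k := by
    intro m w hw
    have := verts_le w; rw [nV]; have := edges_le w hw; omega
  have hDpos : ∀ {m : ℕ} (w : Fin (2 * k + 1) → Fin m), GoodW w →
      0 < (R.descFactorial (nV w) : ℝ) := by
    intro m w hw
    refine lt_of_lt_of_le ?_ (desc_lower R _ k (hv1 w) (hvk w hw) hkR)
    have : 0 < (R : ℝ) - k := lt_of_lt_of_le (by positivity) hR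
    positivity
  have step1 : ∀ w ∈ Finset.univ.filter (fun w : Fin (2 * k + 1) → Fin n => GoodW w),
      p ^ ((nV w) - 1) =
      ∑ w' ∈ Finset.univ.filter (fun w : Fin (2 * k + 1) → Fin R => GoodW w),
        if SameK w w' then p ^ ((nV w') - 1) /
          (R.descFactorial (nV w') : ℝ) else 0 := by
    intro w hw
    simp only [Finset.mem_filter, Finset.mem_univ, true_and] at hw
    rw [← Finset.sum_filter, Finset.filter_filter]
    have h1 : (Finset.univ.filter fun w' : Fin (2 * k + 1) → Fin R => GoodW w' ∧ SameK w w') =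
        Finset.univ.filter fun w' : Fin (2 * k + 1) → Fin R => SameK w w' := by
      ext w'; simp only [Finset.mem_filter, Finset.mem_univ, true_and]
      exact ⟨fun h => h.2, fun h => ⟨h.good hw, h⟩⟩
    rw [h1, Finset.sum_congr rfl (g := fun _ => p ^ ((nV w) - 1) /
          (R.descFactorial (nV w) : ℝ))]
    · rw [Finset.sum_const, fibre_card, Fintype.card_fin, nsmul_eq_mul]
      field_simp [(hDpos w hw).ne']
    · intro w' hw'
      simp only [Finset.mem_filter, Finset.mem_univ, true_and] at hw'
      rw [hw'.card_eq]
  have hc : (n : ℝ) / R * (Finset.univ.filter (fun w : Fin (2 * k + 1) → Fin R => GoodW w)).card =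
      ∑ _w ∈ Finset.univ.filter (fun w : Fin (2 * k + 1) → Fin R => GoodW w), (n : ℝ) / R := by
    rw [Finset.sum_const, nsmul_eq_mul, mul_comm]
  rw [Finset.sum_congr rfl step1, Finset.sum_comm, hc]
  refine Finset.sum_le_sum fun w' hw' => ?_
  simp only [Finset.mem_filter, Finset.mem_univ, true_and] at hw'
  rw [← Finset.sum_filter, Finset.filter_filter]
  have h1 : (Finset.univ.filter fun w : Fin (2 * k + 1) → Fin n => GoodW w ∧ SameK w w') =
      Finset.univ.filter fun w : Fin (2 * k + 1) → Fin n => SameK w' w := by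
    ext w; simp only [Finset.mem_filter, Finset.mem_univ, true_and]
    exact ⟨fun h => h.2.symm, fun h => ⟨h.good hw', h.symm⟩⟩
  rw [h1, Finset.sum_const, fibre_card, Fintype.card_fin, nsmul_eq_mul, ← mul_div_assoc,
    div_le_div_iff₀ (hDpos w' hw') hRpos]
  set v := (nV w')
  have a1 := desc_upper n v (hv1 w') p hp.le
  have a2 := desc_lower R v k (hv1 w') (hvk w' hw') hkR
  calc _ ≤ n * (n * p) ^ (v - 1) * R := by gcongr
    _ ≤ n * ((R : ℝ) - k) ^ (v - 1) * R := by gcongr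
    _ = n * (R * ((R : ℝ) - k) ^ (v - 1)) := by ring
    _ ≤ _ := by gcongr


/-- Ordered pairs indexing the upper triangular entries. -/
abbrev Ed (n : ℕ) := {q : Fin n × Fin n // q.1 < q.2}

/-- Random symmetric zero-diagonal matrix with bounded independent entries. -/
structure RS {n : ℕ} {Ω : Type} [MeasurableSpace Ω] (μ : Measure Ω)
    (M : Ω → Matrix (Fin n) (Fin n) ℝ) : Prop where
  symm : ∀ ω i j, M ω i j = M ω j i
  diag : ∀ ω i, M ω i i = 0
  bdd : ∀ ω i j, |M ω i j| ≤ 2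
  meas : ∀ i j, Measurable fun ω => M ω i j
  indep : iIndepFun (fun (q : Ed n) => fun ω => M ω q.1.1 q.1.2) μ
  mean : ∀ q : Ed n, ∫ ω, M ω q.1.1 q.1.2 ∂μ = 0

lemma exists_edge {n : ℕ} (a b : Fin n) (h : a ≠ b) :
    ∃ e : Ed n, s(e.1.1, e.1.2) = s(a, b) := by
  rcases lt_or_gt_of_ne h with h | h
  · exact ⟨⟨(a, b), h⟩, rfl⟩
  · exact ⟨⟨(b, a), h⟩, Sym2.eq_swap⟩

lemma edge_inj {n : ℕ} (e e' : Ed n) (h : s(e.1.1, e.1.2) = s(e'.1.1, e'.1.2)) : e = e' := by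
  obtain ⟨⟨a, b⟩, h1⟩ := e
  obtain ⟨⟨c, d⟩, h2⟩ := e'
  simp only [Sym2.eq_iff] at h
  simp only at h1 h2
  rcases h with ⟨rfl, rfl⟩ | ⟨rfl, rfl⟩
  · rfl
  · exact absurd h1 (lt_asymm h2)

section
variable {n : ℕ} {Ω : Type} [MeasurableSpace Ω] {μ : Measure Ω} [IsProbabilityMeasure μ]
    {M : Ω → Matrix (Fin n) (Fin n) ℝ}

lemma RS.edge (h : RS μ M) (ω : Ω) (e : Ed n) (a b : Fin n) (he : s(e.1.1, e.1.2) = s(a, b)) :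
    M ω a b = M ω e.1.1 e.1.2 := by
  simp only [Sym2.eq_iff] at he
  rcases he with ⟨h1, h2⟩ | ⟨h1, h2⟩
  · rw [h1, h2]
  · rw [h1, h2, h.symm]

lemma RS.int_pow (h : RS μ M) (i j : Fin n) (m : ℕ) : Integrable (fun ω => M ω i j ^ m) μ := by
  refine Integrable.of_bound (C := 2 ^ m) ((h.meas i j).pow_const m).aestronglyMeasurable ?_
  refine Filter.Eventually.of_forall fun ω => ?_
  rw [norm_pow, Real.norm_eq_abs]
  exact pow_le_pow_left₀ (abs_nonneg _) (h.bdd ω i j) m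

lemma RS.int_prod (h : RS μ M) {N : ℕ} (w : Fin (N + 1) → Fin n) :
    Integrable (fun ω => ∏ t : Fin N, M ω (w t.castSucc) (w t.succ)) μ := by
  refine Integrable.of_bound (C := 2 ^ N)
    (Finset.measurable_prod _ fun t _ => h.meas _ _).aestronglyMeasurable ?_
  refine Filter.Eventually.of_forall fun ω => ?_
  rw [norm_prod]
  calc _ ≤ ∏ _t : Fin N, (2 : ℝ) := Finset.prod_le_prod (fun _ _ => norm_nonneg _)
        (fun t _ => h.bdd ω _ _)
    _ = 2 ^ N := by simp

lemma RS.walk_int (h : RS μ M) {N : ℕ} (w : Fin (N + 1) → Fin n)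
    (hl : ∀ t : Fin N, w t.castSucc ≠ w t.succ) :
    ∃ e : Fin N → Ed n, (∀ s t, e s = e t ↔ wedge w s = wedge w t) ∧
      ∫ ω, ∏ t : Fin N, M ω (w t.castSucc) (w t.succ) ∂μ =
        ∏ q : Ed n, ∫ ω, (M ω q.1.1 q.1.2) ^ (Finset.univ.filter fun t => e t = q).card ∂μ := by
  choose e he using fun t => exists_edge _ _ (hl t)
  refine ⟨e, fun s t => ⟨fun hst => ?_, fun hst => ?_⟩, ?_⟩
  · rw [wedge, wedge, ← he, ← he, hst]
  · refine edge_inj _ _ ?_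
    rw [he, he]; exact hst
  · have h1 : ∀ ω, ∏ t : Fin N, M ω (w t.castSucc) (w t.succ) =
        ∏ q : Ed n, (M ω q.1.1 q.1.2) ^ (Finset.univ.filter fun t => e t = q).card := by
      intro ω
      rw [← Finset.prod_fiberwise (Finset.univ) e]
      refine Finset.prod_congr rfl fun q _ => ?_
      rw [Finset.prod_congr rfl (g := fun _ => M ω q.1.1 q.1.2), Finset.prod_const]
      intro t ht
      simp only [Finset.mem_filter, Finset.mem_univ, true_and] at ht
      rw [h.edge ω (e t) _ _ (he t), ht]
    simp only [h1]
    exact h.indep.integral_fun_prod_comp (f := fun q x => x ^ (Finset.univ.filter fun t => e t = q).card)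
      (fun q => (h.meas _ _).aemeasurable)
      (fun q => (by fun_prop : Measurable _).aestronglyMeasurable)

lemma RS.walk_bad (h : RS μ M) {N : ℕ} (w : Fin (N + 1) → Fin n)
    (hc : w 0 = w (Fin.last N)) (hw : ¬ GoodW w) :
    ∫ ω, ∏ t : Fin N, M ω (w t.castSucc) (w t.succ) ∂μ = 0 := by
  by_cases hl : ∀ t : Fin N, w t.castSucc ≠ w t.succ
  · obtain ⟨e, he, hi⟩ := h.walk_int w hl
    have : ∃ t, ∀ s, s ≠ t → wedge w s ≠ wedge w t := by
      by_contra hcon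
      push Not at hcon
      exact hw ⟨hc, hl, hcon⟩
    obtain ⟨t, ht⟩ := this
    rw [hi]
    refine Finset.prod_eq_zero (Finset.mem_univ (e t)) ?_
    have h1 : (Finset.univ.filter fun s => e s = e t) = {t} := by
      ext s
      simp only [Finset.mem_filter, Finset.mem_univ, true_and, Finset.mem_singleton]
      constructor
      · intro hs
        by_contra hne
        exact ht s hne ((he s t).1 hs)
      · rintro rfl; rfl
    simp only [h1, Finset.card_singleton, pow_one]
    exact h.mean _
  · push Not at hl
    obtain ⟨t, ht⟩ := hl
    have : ∀ ω, ∏ t : Fin N, M ω (w t.castSucc) (w t.succ) = 0 := by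
      intro ω
      refine Finset.prod_eq_zero (Finset.mem_univ t) ?_
      rw [ht, h.diag]
    simp [this]

open Classical in
lemma RS.trace_eq (h : RS μ M) (N : ℕ) :
    ∫ ω, trace (M ω ^ N) ∂μ =
      ∑ w ∈ Finset.univ.filter (fun w : Fin (N + 1) → Fin n => GoodW w),
        ∫ ω, ∏ t : Fin N, M ω (w t.castSucc) (w t.succ) ∂μ := by
  simp only [trace_walk]
  rw [integral_finsetSum]
  · rw [Finset.sum_filter]
    refine Finset.sum_congr rfl fun w _ => ?_
    by_cases hc : w 0 = w (Fin.last N)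
    · simp only [hc, if_true]
      by_cases hw : GoodW w
      · rw [if_pos hw]
      · rw [if_neg hw, h.walk_bad w hc hw]
    · simp only [hc, if_false, integral_zero]
      rw [if_neg (fun hw => hc hw.1)]
  · intro w _
    by_cases hc : w 0 = w (Fin.last N)
    · simp only [hc, if_true]; exact h.int_prod w
    · simp [hc]

lemma RS.two_le {N : ℕ} {w : Fin (N + 1) → Fin n} (hw : GoodW w) {e : Fin N → Ed n}
    (he : ∀ s t, e s = e t ↔ wedge w s = wedge w t) (q : Ed n) :
    (Finset.univ.filter fun t => e t = q).card = 0 ∧ q ∉ Finset.univ.image e ∨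
    2 ≤ (Finset.univ.filter fun t => e t = q).card ∧ q ∈ Finset.univ.image e := by
  by_cases hq : q ∈ Finset.univ.image e
  · right
    refine ⟨?_, hq⟩
    obtain ⟨t, -, rfl⟩ := Finset.mem_image.mp hq
    obtain ⟨s, hs, hst⟩ := hw.2.2 t
    have : 1 < (Finset.univ.filter fun x => e x = e t).card := by
      rw [Finset.one_lt_card]
      exact ⟨s, by simp [(he s t).2 hst], t, by simp, hs⟩
    exact this
  · left
    refine ⟨?_, hq⟩
    rw [Finset.card_eq_zero, Finset.filter_eq_empty_iff]
    intro t _ ht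
    exact hq (Finset.mem_image.mpr ⟨t, Finset.mem_univ _, ht⟩)

open Classical in
lemma RS.trace_upper (h : RS μ M) (N : ℕ) (p : ℝ) (hp : 0 < p) (hp1 : p ≤ 1)
    (hm : ∀ (q : Ed n) (m : ℕ), 2 ≤ m → |∫ ω, (M ω q.1.1 q.1.2) ^ m ∂μ| ≤ p) :
    ∫ ω, trace (M ω ^ N) ∂μ ≤
      ∑ w ∈ Finset.univ.filter (fun w : Fin (N + 1) → Fin n => GoodW w), p ^ (nV w - 1) := by
  rw [h.trace_eq]
  refine Finset.sum_le_sum fun w hw => ?_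
  simp only [Finset.mem_filter, Finset.mem_univ, true_and] at hw
  obtain ⟨e, he, hi⟩ := h.walk_int w hw.2.1
  rw [hi]
  refine (le_abs_self _).trans ?_
  rw [Finset.abs_prod]
  have h1 : ∀ q : Ed n, |∫ ω, (M ω q.1.1 q.1.2) ^ (Finset.univ.filter fun t => e t = q).card ∂μ| ≤
      if q ∈ Finset.univ.image e then p else 1 := by
    intro q
    rcases RS.two_le hw he q with ⟨h2, h3⟩ | ⟨h2, h3⟩
    · rw [if_neg h3, h2]; simp
    · rw [if_pos h3]; exact hm q _ h2
  refine (Finset.prod_le_prod (fun _ _ => abs_nonneg _) (fun q _ => h1 q)).trans ?_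
  rw [Finset.prod_ite_mem, Finset.univ_inter, Finset.prod_const]
  refine pow_le_pow_of_le_one hp.le hp1 ?_
  have hv : nV w ≤ nV (wedge w) + 1 := by
    have := verts_le w
    unfold nV; convert this
  have h5 : nV e = nV (wedge w) := SameK.card_eq (w := e) (w' := wedge w) he
  have h6 : nV e = (Finset.univ.image e).card := by
    unfold nV; congr; exact Subsingleton.elim _ _
  omega

open Classical in
lemma RS.trace_lower (h : RS μ M) (N : ℕ)
    (hm : ∀ (q : Ed n) (m : ℕ), 2 ≤ m → 1 ≤ ∫ ω, (M ω q.1.1 q.1.2) ^ m ∂μ) :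
    ((Finset.univ.filter (fun w : Fin (N + 1) → Fin n => GoodW w)).card : ℝ) ≤
    ∫ ω, trace (M ω ^ N) ∂μ := by
  rw [h.trace_eq]
  have hc : ((Finset.univ.filter (fun w : Fin (N + 1) → Fin n => GoodW w)).card : ℝ) =
      ∑ _w ∈ Finset.univ.filter (fun w : Fin (N + 1) → Fin n => GoodW w), (1 : ℝ) := by simp
  rw [hc]
  refine Finset.sum_le_sum fun w hw => ?_
  simp only [Finset.mem_filter, Finset.mem_univ, true_and] at hw
  obtain ⟨e, he, hi⟩ := h.walk_int w hw.2.1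
  rw [hi]
  rw [← Finset.prod_const_one (s := (Finset.univ : Finset (Ed n)))]
  refine Finset.prod_le_prod (fun _ _ => zero_le_one) fun q _ => ?_
  rcases RS.two_le hw he q with ⟨h2, h3⟩ | ⟨h2, h3⟩
  · rw [h2]; simp
  · exact hm q _ h2

end


lemma exists_net (R : ℕ) : ∃ s : Finset (EuclideanSpace ℝ (Fin R)), s.card ≤ 5 ^ R ∧
    (∀ c ∈ s, ‖c‖ ≤ 2) ∧ ∀ x : EuclideanSpace ℝ (Fin R), ‖x‖ ≤ 2 → ∃ c ∈ s, ‖x - c‖ < 1 := by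
  classical
  let G : ℕ → Prop := fun m => ∃ s : Finset (EuclideanSpace ℝ (Fin R)), s.card = m ∧
    (∀ c ∈ s, ‖c‖ ≤ 2) ∧ ∀ c ∈ s, ∀ d ∈ s, c ≠ d → 1 ≤ ‖c - d‖
  have hG : ∀ m, G m → m ≤ 5 ^ R := by
    rintro m ⟨s, rfl, h1, h2⟩
    have := Besicovitch.card_le_of_separated s h1 h2
    simpa using this
  have h0 : G 0 := ⟨∅, by simp⟩
  have hmax := Nat.findGreatest_spec (P := G) (Nat.zero_le (5 ^ R)) h0
  obtain ⟨s, hs, h1, h2⟩ := hmax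
  refine ⟨s, hG _ ⟨s, rfl, h1, h2⟩, h1, fun x hx => ?_⟩
  by_contra hcon
  push Not at hcon
  have hxs : x ∉ s := fun h => by
    have := hcon x h; simp at this; linarith
  have hG1 : G (s.card + 1) := by
    refine ⟨insert x s, Finset.card_insert_of_notMem hxs, ?_, ?_⟩
    · intro c hc
      rcases Finset.mem_insert.mp hc with rfl | hc
      · exact hx
      · exact h1 c hc
    · intro c hc d hd hcd
      rcases Finset.mem_insert.mp hc with h3 | h3 <;> rcases Finset.mem_insert.mp hd with h4 | h4
      · exact absurd (h3.trans h4.symm) hcd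
      · rw [h3]; exact hcon d h4
      · rw [norm_sub_rev, h4]; exact hcon c h3
      · exact h2 c h3 d h4 hcd
  have := Nat.le_findGreatest (hG _ hG1) hG1
  omega

lemma norm_le_net {R : ℕ} {s : Finset (EuclideanSpace ℝ (Fin R))}
    (hs : ∀ x : EuclideanSpace ℝ (Fin R), ‖x‖ ≤ 2 → ∃ c ∈ s, ‖x - c‖ < 1)
    (T : EuclideanSpace ℝ (Fin R) →L[ℝ] EuclideanSpace ℝ (Fin R)) :
    ∃ c ∈ s, ∃ d ∈ s, ‖T‖ ≤ inner ℝ c (T d) := by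
  have hne : s.Nonempty := by
    obtain ⟨c, hc, -⟩ := hs 0 (by simp)
    exact ⟨c, hc⟩
  obtain ⟨d, hd, hmax⟩ := s.exists_max_image (fun d => ‖T d‖) hne
  have hT : ‖T‖ ≤ ‖T d‖ := by
    have : ‖T‖ ≤ (‖T d‖ + ‖T‖) / 2 := by
      refine ContinuousLinearMap.opNorm_le_bound _ (by positivity) fun x => ?_
      by_cases hx : x = 0
      · simp [hx]
      have hx' : 0 < ‖x‖ := norm_pos_iff.mpr hx
      obtain ⟨e, he, hlt⟩ := hs ((2 / ‖x‖) • x) (by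
        rw [norm_smul, Real.norm_of_nonneg (by positivity), div_mul_cancel₀ _ hx'.ne'])
      have h1 : T ((2 / ‖x‖) • x) = T e + T ((2 / ‖x‖) • x - e) := by rw [← map_add]; simp
      have h2 : ‖T ((2 / ‖x‖) • x)‖ ≤ ‖T d‖ + ‖T‖ := by
        rw [h1]
        refine (norm_add_le _ _).trans ?_
        have := T.le_opNorm ((2 / ‖x‖) • x - e)
        have := hmax e he
        nlinarith [norm_nonneg T]
      rw [map_smul, norm_smul, Real.norm_of_nonneg (by positivity), div_mul_eq_mul_div,
        div_le_iff₀ hx'] at h2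
      linarith
    linarith
  by_cases hz : T d = 0
  · obtain ⟨c, hc⟩ := hne
    refine ⟨c, hc, d, hd, ?_⟩
    rw [hz] at hT ⊢; simpa using hT
  have hz' : 0 < ‖T d‖ := norm_pos_iff.mpr hz
  obtain ⟨c, hc, hlt⟩ := hs ((2 / ‖T d‖) • T d) (by
    rw [norm_smul, Real.norm_of_nonneg (by positivity), div_mul_cancel₀ _ hz'.ne'])
  refine ⟨c, hc, d, hd, hT.trans ?_⟩
  have h1 := real_inner_le_norm ((2 / ‖T d‖) • T d - c) (T d)
  rw [inner_sub_left, real_inner_smul_left, real_inner_self_eq_norm_sq] at h1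
  have h2 : 2 / ‖T d‖ * ‖T d‖ ^ 2 = 2 * ‖T d‖ := by field_simp
  rw [h2] at h1
  nlinarith

lemma RS.exp_lin {n : ℕ} {Ω : Type} [MeasurableSpace Ω] {μ : Measure Ω} [IsProbabilityMeasure μ]
    {M : Ω → Matrix (Fin n) (Fin n) ℝ} (h : RS μ M) (a : Ed n → ℝ) :
    ∫ ω, Real.exp (∑ q, a q * M ω q.1.1 q.1.2) ∂μ ≤ Real.exp (2 * ∑ q, (a q) ^ 2) := by
  simp only [Real.exp_sum]
  have h1 := h.indep.integral_fun_prod_comp (f := fun q x => Real.exp (a q * x))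
      (fun q => (h.meas _ _).aemeasurable)
      (fun q => (by fun_prop : Measurable _).aestronglyMeasurable)
  rw [h1, Finset.mul_sum, Real.exp_sum]
  refine Finset.prod_le_prod (fun _ _ => integral_nonneg fun _ => (Real.exp_pos _).le) fun q _ => ?_
  have h2 := hasSubgaussianMGF_of_mem_Icc_of_integral_eq_zero (a := -2) (b := 2)
    (h.meas q.1.1 q.1.2).aemeasurable
    (Filter.Eventually.of_forall fun ω => abs_le.mp (h.bdd ω _ _)) (h.mean q)
  refine (h2.mgf_le (a q)).trans (Real.exp_le_exp.mpr (le_of_eq ?_))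
  push_cast
  norm_num
  ring

lemma quad_upper {n : ℕ} (B : Matrix (Fin n) (Fin n) ℝ) (hs : ∀ i j, B i j = B j i)
    (hd : ∀ i, B i i = 0) (c d : EuclideanSpace ℝ (Fin n)) :
    inner ℝ c (cl B d) = ∑ q : Ed n, (c q.1.1 * d q.1.2 + c q.1.2 * d q.1.1) * B q.1.1 q.1.2 := by
  have h1 : inner ℝ c (cl B d) = ∑ q : Fin n × Fin n, c q.1 * B q.1 q.2 * d q.2 := by
    rw [Fintype.sum_prod_type, PiLp.inner_apply]
    refine Finset.sum_congr rfl fun i _ => ?_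
    rw [cl_apply]
    simp only [RCLike.inner_apply, conj_trivial, Finset.sum_mul]
    exact Finset.sum_congr rfl fun j _ => by ring
  have h2 : ∀ q : Fin n × Fin n, c q.1 * B q.1 q.2 * d q.2 =
      (if q.1 < q.2 then c q.1 * B q.1 q.2 * d q.2 else 0) +
      (if q.2 < q.1 then c q.1 * B q.1 q.2 * d q.2 else 0) := by
    intro q
    rcases lt_trichotomy q.1 q.2 with h | h | h
    · simp [h, lt_asymm h]
    · rw [h, hd]; simp
    · simp [h, lt_asymm h]
  rw [h1, Finset.sum_congr rfl (fun q _ => h2 q), Finset.sum_add_distrib,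
    ← (Equiv.prodComm (Fin n) (Fin n)).sum_comp (fun q => if q.2 < q.1 then c q.1 * B q.1 q.2 * d q.2 else 0),
    ← Finset.sum_add_distrib]
  have h3 : ∑ q : Ed n, (c q.1.1 * d q.1.2 + c q.1.2 * d q.1.1) * B q.1.1 q.1.2 =
      ∑ q ∈ Finset.univ.filter fun q : Fin n × Fin n => q.1 < q.2,
        (c q.1 * d q.2 + c q.2 * d q.1) * B q.1 q.2 :=
    (Finset.sum_subtype _ (by simp)
      (fun q : Fin n × Fin n => (c q.1 * d q.2 + c q.2 * d q.1) * B q.1 q.2)).symm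
  rw [h3]
  rw [Finset.sum_filter]
  refine Finset.sum_congr rfl fun q _ => ?_
  by_cases hq : q.1 < q.2
  · simp [hq, hs q.2 q.1]; ring
  · simp [hq]

lemma sum_ed_le {n : ℕ} (f : Fin n × Fin n → ℝ) (hf : ∀ q, 0 ≤ f q) :
    ∑ q : Ed n, f q.1 ≤ ∑ q, f q := by
  have h3 : ∑ q : Ed n, f q.1 = ∑ q ∈ Finset.univ.filter fun q : Fin n × Fin n => q.1 < q.2, f q :=
    (Finset.sum_subtype _ (by simp) f).symm
  rw [h3]
  exact Finset.sum_le_sum_of_subset_of_nonneg (Finset.filter_subset _ _) fun _ _ _ => hf _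

lemma RS.exp_quad {n : ℕ} {Ω : Type} [MeasurableSpace Ω] {μ : Measure Ω} [IsProbabilityMeasure μ]
    {M : Ω → Matrix (Fin n) (Fin n) ℝ} (h : RS μ M) (c d : EuclideanSpace ℝ (Fin n))
    (hc : ‖c‖ ≤ 2) (hd : ‖d‖ ≤ 2) (θ : ℝ) :
    ∫ ω, Real.exp (θ * inner ℝ c (cl (M ω) d)) ∂μ ≤ Real.exp (128 * θ ^ 2) := by
  have h1 : ∀ ω, θ * inner ℝ c (cl (M ω) d) =
      ∑ q : Ed n, (θ * (c q.1.1 * d q.1.2 + c q.1.2 * d q.1.1)) * M ω q.1.1 q.1.2 := by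
    intro ω
    rw [quad_upper _ (h.symm ω) (h.diag ω), Finset.mul_sum]
    exact Finset.sum_congr rfl fun q _ => by ring
  simp only [h1]
  refine (h.exp_lin _).trans (Real.exp_le_exp.mpr ?_)
  have h2 : ∑ q : Ed n, (θ * (c q.1.1 * d q.1.2 + c q.1.2 * d q.1.1)) ^ 2 ≤
      ∑ q : Fin n × Fin n, θ ^ 2 * (2 * (c q.1 ^ 2 * d q.2 ^ 2) + 2 * (d q.1 ^ 2 * c q.2 ^ 2)) := by
    refine le_trans ?_ (sum_ed_le _ fun q => by positivity)
    refine Finset.sum_le_sum fun q _ => ?_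
    rw [mul_pow]
    gcongr
    nlinarith [sq_nonneg (c q.1.1 * d q.1.2 - c q.1.2 * d q.1.1)]
  have h3 : ∑ q : Fin n × Fin n, θ ^ 2 * (2 * (c q.1 ^ 2 * d q.2 ^ 2) + 2 * (d q.1 ^ 2 * c q.2 ^ 2)) =
      θ ^ 2 * (4 * (‖c‖ ^ 2 * ‖d‖ ^ 2)) := by
    rw [← Finset.mul_sum, Finset.sum_add_distrib, ← Finset.mul_sum, ← Finset.mul_sum,
      Fintype.sum_prod_type, Fintype.sum_prod_type]
    simp only
    rw [← Finset.sum_mul_sum, ← Finset.sum_mul_sum, nsq, nsq]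
    ring
  have h4 : ‖c‖ ^ 2 * ‖d‖ ^ 2 ≤ 2 ^ 2 * 2 ^ 2 := by gcongr
  rw [h3] at h2
  nlinarith [sq_nonneg θ]

lemma RS.exp_norm {n : ℕ} {Ω : Type} [MeasurableSpace Ω] [Finite Ω] [MeasurableSingletonClass Ω]
    {μ : Measure Ω} [IsProbabilityMeasure μ]
    {M : Ω → Matrix (Fin n) (Fin n) ℝ} (h : RS μ M) (θ : ℝ) (hθ : 0 ≤ θ) :
    ∫ ω, Real.exp (θ * ‖cl (M ω)‖) ∂μ ≤ 25 ^ n * Real.exp (128 * θ ^ 2) := by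
  obtain ⟨s, hs, hs2, hnet⟩ := exists_net n
  calc ∫ ω, Real.exp (θ * ‖cl (M ω)‖) ∂μ
      ≤ ∫ ω, ∑ q ∈ s ×ˢ s, Real.exp (θ * inner ℝ q.1 (cl (M ω) q.2)) ∂μ := by
        refine integral_mono Integrable.of_finite Integrable.of_finite fun ω => ?_
        obtain ⟨c, hc, d, hd, hcd⟩ := norm_le_net hnet (cl (M ω))
        refine le_trans ?_ (Finset.single_le_sum (f := fun q : _ × _ => Real.exp (θ * inner ℝ q.1 (cl (M ω) q.2)))
          (fun _ _ => (Real.exp_pos _).le) (Finset.mk_mem_product hc hd))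
        exact Real.exp_le_exp.mpr (by gcongr)
    _ = ∑ q ∈ s ×ˢ s, ∫ ω, Real.exp (θ * inner ℝ q.1 (cl (M ω) q.2)) ∂μ :=
        integral_finsetSum _ fun _ _ => Integrable.of_finite
    _ ≤ ∑ q ∈ s ×ˢ s, Real.exp (128 * θ ^ 2) := by
        refine Finset.sum_le_sum fun q hq => ?_
        rw [Finset.mem_product] at hq
        exact h.exp_quad _ _ (hs2 _ hq.1) (hs2 _ hq.2) θ
    _ = ((s.card : ℝ) * s.card) * Real.exp (128 * θ ^ 2) := by
        rw [Finset.sum_const, Finset.card_product, nsmul_eq_mul]; push_cast; ring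
    _ ≤ ((5 : ℝ) ^ n * 5 ^ n) * Real.exp (128 * θ ^ 2) := by
        have : (s.card : ℝ) ≤ 5 ^ n := by exact_mod_cast hs
        gcongr
    _ = _ := by rw [← mul_pow]; norm_num

/-- Moment bound for the operator norm. -/
lemma RS.norm_moment {n : ℕ} {Ω : Type} [MeasurableSpace Ω] [Finite Ω] [MeasurableSingletonClass Ω]
    {μ : Measure Ω} [IsProbabilityMeasure μ]
    {M : Ω → Matrix (Fin n) (Fin n) ℝ} (h : RS μ M) (hn : 0 < n) (k : ℕ) (hk : k ≤ n) :
    ∫ ω, ‖cl (M ω)‖ ^ (2 * k) ∂μ ≤ 2 * (100 * Real.exp 128 * n) ^ k := by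
  have hn' : (0 : ℝ) < n := by exact_mod_cast hn
  set K : ℝ := 100 * Real.exp 128 * n with hK
  have hKpos : 0 < K := by positivity
  have h1 : ∫ ω, ‖cl (M ω)‖ ^ (2 * n) ∂μ ≤ K ^ n := by
    have hpt : ∀ ω, ‖cl (M ω)‖ ^ (2 * n) ≤ (4 * n) ^ n * Real.exp (Real.sqrt n * ‖cl (M ω)‖) := by
      intro ω
      have h2 := Real.pow_div_factorial_le_exp (x := Real.sqrt n * ‖cl (M ω)‖) (by positivity) (2 * n)
      rw [div_le_iff₀ (by positivity), mul_pow] at h2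
      have h3 : Real.sqrt n ^ (2 * n) = (n : ℝ) ^ n := by
        rw [pow_mul, Real.sq_sqrt hn'.le]
      have h4 : ((2 * n).factorial : ℝ) ≤ (2 * n : ℝ) ^ (2 * n) := by
        exact_mod_cast Nat.factorial_le_pow (2 * n)
      have h5 : (2 * n : ℝ) ^ (2 * n) = (n : ℝ) ^ n * (4 * n) ^ n := by
        rw [pow_mul, ← mul_pow]; ring
      rw [h3] at h2
      have h6 : (n : ℝ) ^ n * ‖cl (M ω)‖ ^ (2 * n) ≤
          (n : ℝ) ^ n * ((4 * n) ^ n * Real.exp (Real.sqrt n * ‖cl (M ω)‖)) := by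
        refine h2.trans ?_
        rw [← mul_assoc, ← h5, mul_comm]
        gcongr
      exact le_of_mul_le_mul_left h6 (by positivity)
    calc _ ≤ ∫ ω, (4 * n : ℝ) ^ n * Real.exp (Real.sqrt n * ‖cl (M ω)‖) ∂μ :=
          integral_mono Integrable.of_finite Integrable.of_finite hpt
      _ = (4 * n : ℝ) ^ n * ∫ ω, Real.exp (Real.sqrt n * ‖cl (M ω)‖) ∂μ := integral_const_mul _ _
      _ ≤ (4 * n : ℝ) ^ n * (25 ^ n * Real.exp (128 * Real.sqrt n ^ 2)) := by
          gcongr; exact h.exp_norm _ (by positivity)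
      _ = K ^ n := by
          rw [Real.sq_sqrt hn'.le, mul_comm 128 (n : ℝ), Real.exp_nat_mul, ← mul_pow, ← mul_pow, hK]
          congr 1; ring
  have hpt : ∀ ω, ‖cl (M ω)‖ ^ (2 * k) ≤ K ^ k * (1 + ‖cl (M ω)‖ ^ (2 * n) / K ^ n) := by
    intro ω
    set u := ‖cl (M ω)‖ ^ 2 / K with hu
    have hu0 : 0 ≤ u := by positivity
    have h2 : u ^ k ≤ 1 + u ^ n := by
      rcases le_total u 1 with h | h
      · have := pow_le_one₀ hu0 h (n := k); have : 0 ≤ u ^ n := by positivity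
        linarith
      · have := pow_le_pow_right₀ h hk; linarith
    have h3 : ‖cl (M ω)‖ ^ (2 * k) = K ^ k * u ^ k := by
      rw [← mul_pow, hu, mul_div_cancel₀ _ hKpos.ne', pow_mul]
    have h4 : ‖cl (M ω)‖ ^ (2 * n) / K ^ n = u ^ n := by
      rw [pow_mul, ← div_pow]
    rw [h3, h4]; gcongr
  calc _ ≤ ∫ ω, K ^ k * (1 + ‖cl (M ω)‖ ^ (2 * n) / K ^ n) ∂μ :=
        integral_mono Integrable.of_finite Integrable.of_finite hpt
    _ = K ^ k * (1 + (∫ ω, ‖cl (M ω)‖ ^ (2 * n) ∂μ) / K ^ n) := by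
        rw [integral_const_mul, integral_add Integrable.of_finite Integrable.of_finite,
          integral_div]; simp
    _ ≤ K ^ k * (1 + 1) := by
        gcongr
        rw [div_le_one (by positivity)]; exact h1
    _ = _ := by ring


/-- Two-valued centred law. -/
def nuB : Measure Bool :=
  ENNReal.ofReal (1 / 3) • Measure.dirac true + ENNReal.ofReal (2 / 3) • Measure.dirac false

instance : IsProbabilityMeasure nuB := by
  constructor
  simp only [nuB, Measure.coe_add, Measure.coe_smul, Pi.add_apply, Pi.smul_apply, measure_univ,
    smul_eq_mul, mul_one]
  rw [← ENNReal.ofReal_add (by norm_num) (by norm_num)]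
  norm_num

lemma integral_nuB (f : Bool → ℝ) : ∫ b, f b ∂nuB = 1 / 3 * f true + 2 / 3 * f false := by
  have i1 : IsFiniteMeasure (ENNReal.ofReal (1 / 3) • (Measure.dirac true : Measure Bool)) :=
    Measure.smul_finite _ ENNReal.ofReal_ne_top
  have i2 : IsFiniteMeasure (ENNReal.ofReal (2 / 3) • (Measure.dirac false : Measure Bool)) :=
    Measure.smul_finite _ ENNReal.ofReal_ne_top
  rw [nuB, integral_add_measure Integrable.of_finite Integrable.of_finite, integral_smul_measure,
    integral_smul_measure, integral_dirac, integral_dirac, ENNReal.toReal_ofReal (by norm_num),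
    ENNReal.toReal_ofReal (by norm_num)]
  simp

/-- The comparison value. -/
def yv (b : Bool) : ℝ := if b then 2 else -1

/-- The comparison random matrix. -/
def yM (R : ℕ) (ω : Ed R → Bool) : Matrix (Fin R) (Fin R) ℝ := fun i j =>
  if h : i < j then yv (ω ⟨(i, j), h⟩) else if h : j < i then yv (ω ⟨(j, i), h⟩) else 0

lemma yv_abs (b : Bool) : |yv b| ≤ 2 := by cases b <;> simp [yv]

lemma yM_edge (R : ℕ) (ω : Ed R → Bool) (q : Ed R) : yM R ω q.1.1 q.1.2 = yv (ω q) := by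
  simp [yM, q.2]

lemma yM_int (R : ℕ) (q : Ed R) (m : ℕ) :
    ∫ ω, (yM R ω q.1.1 q.1.2) ^ m ∂(Measure.pi fun _ : Ed R => nuB) =
      1 / 3 * 2 ^ m + 2 / 3 * (-1) ^ m := by
  simp only [yM_edge]
  have h := (measurePreserving_eval (fun _ : Ed R => nuB) q)
  have h2 := h.map_eq
  have h3 : ∫ b, (yv b) ^ m ∂nuB = ∫ ω, (yv (ω q)) ^ m ∂(Measure.pi fun _ : Ed R => nuB) := by
    conv_lhs => rw [← h2]
    rw [integral_map h.measurable.aemeasurable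
      (Measurable.of_discrete).aestronglyMeasurable]
  rw [← h3, integral_nuB]
  simp [yv]

lemma yM_RS (R : ℕ) : RS (Measure.pi fun _ : Ed R => nuB) (yM R) where
  symm := by
    intro ω i j
    rcases lt_trichotomy i j with h | h | h
    · simp [yM, h, lt_asymm h]
    · rw [h]
    · simp [yM, h, lt_asymm h]
  diag := by intro ω i; simp [yM]
  bdd := by
    intro ω i j
    unfold yM
    split_ifs
    · exact yv_abs _
    · exact yv_abs _
    · simp
  meas := fun i j => measurable_of_finite _
  indep := by
    simp only [yM_edge]
    exact iIndepFun_pi (X := fun _ b => yv b) (fun _ => (measurable_of_finite _).aemeasurable)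
  mean := by
    intro q
    have := yM_int R q 1
    simp only [pow_one] at this
    rw [this]; norm_num

lemma yM_moment (R : ℕ) (q : Ed R) (m : ℕ) (hm : 2 ≤ m) :
    1 ≤ ∫ ω, (yM R ω q.1.1 q.1.2) ^ m ∂(Measure.pi fun _ : Ed R => nuB) := by
  rw [yM_int]
  obtain ⟨j, rfl⟩ : ∃ j, m = j + 2 := ⟨m - 2, by omega⟩
  rcases Nat.even_or_odd j with h | h
  · have : Even (j + 2) := by simpa [Nat.even_add] using h
    rw [this.neg_one_pow, pow_add]
    have : (1 : ℝ) ≤ 2 ^ j := one_le_pow₀ (by norm_num)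
    linarith
  · have h' : Odd (j + 2) := by
      obtain ⟨i, hi⟩ := h
      exact ⟨i + 1, by omega⟩
    rw [h'.neg_one_pow, pow_add]
    have : (2 : ℝ) ^ 1 ≤ 2 ^ j := pow_le_pow_right₀ (by norm_num) h.pos
    linarith

lemma entry_le {n : ℕ} (B : Matrix (Fin n) (Fin n) ℝ) (i j : Fin n) : |B i j| ≤ ‖cl B‖ := by
  have h1 := (cl B).le_opNorm (EuclideanSpace.single j 1)
  rw [show ‖EuclideanSpace.single j (1 : ℝ)‖ = 1 by simp, mul_one] at h1
  have h2 := PiLp.norm_apply_le (cl B (EuclideanSpace.single j 1)) i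
  have h3 : cl B (EuclideanSpace.single j 1) i = B i j := by
    rw [cl_apply]
    simp
  rw [h3, Real.norm_eq_abs] at h2
  exact h2.trans h1

lemma cl_pow {n : ℕ} (B : Matrix (Fin n) (Fin n) ℝ) (k : ℕ) : cl (B ^ k) = cl B ^ k := by
  simp [cl]

lemma trace_pow_le {n : ℕ} (B : Matrix (Fin n) (Fin n) ℝ) (k : ℕ) :
    trace (B ^ k) ≤ n * ‖cl B‖ ^ k := by
  calc trace (B ^ k) ≤ ∑ _i : Fin n, ‖cl B‖ ^ k := by
        refine Finset.sum_le_sum fun i _ => ?_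
        refine (le_abs_self _).trans ((entry_le _ _ _).trans ?_)
        rw [cl_pow]
        rcases Nat.eq_zero_or_pos k with rfl | hk
        · simp only [pow_zero]; exact ContinuousLinearMap.norm_id_le
        · exact norm_pow_le' _ hk
    _ = _ := by simp

lemma cl_selfAdjoint {n : ℕ} (B : Matrix (Fin n) (Fin n) ℝ) (hB : B.IsSymm) :
    IsSelfAdjoint (cl B) := by
  unfold cl
  refine IsSelfAdjoint.map (f := (Matrix.toEuclideanCLM (n := Fin n) (𝕜 := ℝ))) ?_
  rw [IsSelfAdjoint, star_eq_conjTranspose, conjTranspose_eq_transpose_of_trivial]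
  exact hB

lemma selfAdjoint_pow_norm {n : ℕ} {T : EuclideanSpace ℝ (Fin n) →L[ℝ] EuclideanSpace ℝ (Fin n)}
    (hT : IsSelfAdjoint T) (k : ℕ) : ‖T‖ ^ (k + 1) ≤ ‖T ^ (k + 1)‖ := by
  by_cases h0 : T = 0
  · simp [h0]
  have hpos : 0 < ‖T‖ := norm_pos_iff.mpr h0
  have key : ∀ k, 0 < ‖T ^ (k + 1)‖ ∧ ‖T‖ * ‖T ^ (k + 1)‖ ≤ ‖T ^ (k + 2)‖ := by
    intro k
    have hsq : ∀ m, ‖T ^ m‖ * ‖T ^ m‖ = ‖T ^ m * T ^ m‖ := by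
      intro m
      have hs : star (T ^ m) = T ^ m := (hT.pow m)
      have := CStarRing.norm_star_mul_self (x := T ^ m)
      rw [hs] at this; exact this.symm
    induction k with
    | zero =>
      refine ⟨by simpa using hpos, ?_⟩
      have := hsq 1
      simp only [pow_one] at this
      simp only [zero_add, pow_one, this]
      rw [sq]
    | succ k ih =>
      have h1 : 0 < ‖T ^ (k + 1 + 1)‖ := lt_of_lt_of_le (mul_pos hpos ih.1) ih.2
      refine ⟨h1, ?_⟩
      have h2 : ‖T ^ (k + 2)‖ * ‖T ^ (k + 2)‖ ≤ ‖T ^ (k + 1)‖ * ‖T ^ (k + 1 + 2)‖ := by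
        rw [hsq]
        have : T ^ (k + 2) * T ^ (k + 2) = T ^ (k + 1) * T ^ (k + 1 + 2) := by
          rw [← pow_add, ← pow_add]; congr 1; ring
        rw [this]; exact norm_mul_le _ _
      have h3 : ‖T ^ (k + 1)‖ * (‖T‖ * ‖T ^ (k + 1 + 1)‖) ≤
          ‖T ^ (k + 1)‖ * ‖T ^ (k + 1 + 2)‖ := by
        refine le_trans ?_ h2
        have := mul_le_mul_of_nonneg_right ih.2 h1.le
        calc _ = ‖T‖ * ‖T ^ (k + 1)‖ * ‖T ^ (k + 1 + 1)‖ := by ring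
          _ ≤ _ := this
      exact le_of_mul_le_mul_left h3 ih.1
  induction k with
  | zero => simp
  | succ k ih =>
    calc ‖T‖ ^ (k + 1 + 1) = ‖T‖ * ‖T‖ ^ (k + 1) := by ring
      _ ≤ ‖T‖ * ‖T ^ (k + 1)‖ := by gcongr
      _ ≤ _ := (key k).2

lemma norm_sq_le_frob {n : ℕ} (B : Matrix (Fin n) (Fin n) ℝ) :
    ‖cl B‖ ^ 2 ≤ ∑ i, ∑ j, (B i j) ^ 2 := by
  have h0 : 0 ≤ ∑ i, ∑ j, (B i j) ^ 2 := by positivity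
  have h1 : ‖cl B‖ ≤ Real.sqrt (∑ i, ∑ j, (B i j) ^ 2) := by
    refine ContinuousLinearMap.opNorm_le_bound _ (Real.sqrt_nonneg _) fun x => ?_
    refine abs_le_of_sq_le_sq' ?_ (by positivity) |>.2
    rw [mul_pow, Real.sq_sqrt h0, nsq, Finset.sum_mul]
    refine Finset.sum_le_sum fun i _ => ?_
    rw [cl_apply, nsq]
    exact Finset.sum_mul_sq_le_sq_mul_sq _ _ _
  calc _ ≤ Real.sqrt (∑ i, ∑ j, (B i j) ^ 2) ^ 2 := by gcongr
    _ = _ := Real.sq_sqrt h0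

lemma norm_pow_le_trace {n : ℕ} (B : Matrix (Fin n) (Fin n) ℝ) (hB : B.IsSymm) (k : ℕ) :
    ‖cl B‖ ^ (2 * (k + 1)) ≤ trace (B ^ (2 * (k + 1))) := by
  have h1 := selfAdjoint_pow_norm (cl_selfAdjoint B hB) k
  rw [← cl_pow] at h1
  have h2 := norm_sq_le_frob (B ^ (k + 1))
  have h3 : trace (B ^ (2 * (k + 1))) = ∑ i, ∑ j, ((B ^ (k + 1)) i j) ^ 2 := by
    have hs : (B ^ (k + 1)).IsSymm := hB.pow (k + 1)
    rw [two_mul, pow_add, trace]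
    refine Finset.sum_congr rfl fun i _ => ?_
    rw [diag_apply, mul_apply]
    refine Finset.sum_congr rfl fun j _ => ?_
    rw [hs.apply i j, sq]
  rw [h3]
  refine le_trans ?_ h2
  rw [mul_comm 2, pow_mul]
  gcongr

/-- Trace moment bound. -/
lemma RS.trace_moment {n : ℕ} {Ω : Type} [MeasurableSpace Ω] {μ : Measure Ω}
    [IsProbabilityMeasure μ] {M : Ω → Matrix (Fin n) (Fin n) ℝ} (h : RS μ M) (k R : ℕ) (p : ℝ)
    (hp : 0 < p) (hp1 : p ≤ 1) (hn : 0 < n) (hkR : k < R) (hR : (n : ℝ) * p ≤ R - k)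
    (hm : ∀ (q : Ed n) (m : ℕ), 2 ≤ m → |∫ ω, (M ω q.1.1 q.1.2) ^ m ∂μ| ≤ p) :
    ∫ ω, trace (M ω ^ (2 * k)) ∂μ ≤ 2 * n * (100 * Real.exp 128 * R) ^ k := by
  classical
  have hRpos : (0 : ℝ) < R := by exact_mod_cast (by omega : 0 < R)
  have h1 := h.trace_upper (2 * k) p hp hp1 hm
  have h2 := walk_compare n R k p hp hn hkR hR
  have h3 := (yM_RS R).trace_lower (2 * k) (yM_moment R)
  have h4 : ∫ ω, trace (yM R ω ^ (2 * k)) ∂(Measure.pi fun _ : Ed R => nuB) ≤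
      R * (2 * (100 * Real.exp 128 * R) ^ k) := by
    refine le_trans (integral_mono (g := fun ω => R * ‖cl (yM R ω)‖ ^ (2 * k))
      Integrable.of_finite Integrable.of_finite fun ω => trace_pow_le _ _) ?_
    rw [integral_const_mul]
    gcongr
    exact (yM_RS R).norm_moment (by omega) k hkR.le
  calc _ ≤ _ := h1
    _ ≤ _ := by convert h2
    _ ≤ n / R * (R * (2 * (100 * Real.exp 128 * R) ^ k)) := by
        gcongr
        convert h3.trans h4
    _ = _ := by field_simp

/-- Spectral norm tail bound. -/
lemma RS.spec_tail {n : ℕ} {Ω : Type} [MeasurableSpace Ω] {μ : Measure Ω}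
    [IsProbabilityMeasure μ] {M : Ω → Matrix (Fin n) (Fin n) ℝ} (h : RS μ M) (p c : ℝ)
    (hp : 0 < p) (hp1 : p ≤ 1) (hc : 0 < c) (hn : 1 ≤ Real.log n) (hn0 : 0 < n)
    (hq : c * Real.log n ≤ n * p)
    (hm : ∀ (q : Ed n) (m : ℕ), 2 ≤ m → |∫ ω, (M ω q.1.1 q.1.2) ^ m ∂μ| ≤ p) :
    ∃ G : Set Ω, MeasurableSet G ∧ μ.real Gᶜ ≤ 2 / (n : ℝ) ^ 2 ∧
      ∀ ω ∈ G, ‖cl (M ω)‖ ^ 2 ≤ 100 * Real.exp 128 * Real.exp 3 * (1 + 3 / c) * (n * p) := by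
  have hnpos : (0 : ℝ) < n := by exact_mod_cast hn0
  obtain ⟨k, hk⟩ : ∃ k, ⌈Real.log n⌉₊ = k + 1 :=
    ⟨⌈Real.log n⌉₊ - 1, by have := Nat.ceil_pos.mpr (by linarith : 0 < Real.log n); omega⟩
  have hk1 : Real.log n ≤ (k + 1 : ℕ) := by rw [← hk]; exact Nat.le_ceil _
  have hk2 : ((k + 1 : ℕ) : ℝ) ≤ Real.log n + 1 := by
    rw [← hk]; exact (Nat.ceil_lt_add_one (by linarith)).le
  have hqpos : 0 < n * p := by positivity
  set R := ⌈n * p⌉₊ + (k + 1) with hR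
  have hcp : 0 < ⌈n * p⌉₊ := Nat.ceil_pos.mpr hqpos
  have hR1 : n * p ≤ (R : ℝ) - (k + 1 : ℕ) := by
    rw [hR]; push_cast; have := Nat.le_ceil (n * p); linarith
  have hRpos : (0 : ℝ) < R := by exact_mod_cast (by omega : 0 < R)
  have hR2 : (R : ℝ) ≤ (1 + 3 / c) * (n * p) := by
    have h1 := (Nat.ceil_lt_add_one hqpos.le).le
    have h2 : (R : ℝ) = (⌈n * p⌉₊ : ℝ) + ((k + 1 : ℕ) : ℝ) := by rw [hR]; push_cast; ring
    have h3 : 3 * Real.log n ≤ 3 / c * (n * p) := by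
      rw [div_mul_eq_mul_div, le_div_iff₀ hc]; linarith
    rw [h2]; linarith
  have h1 := h.trace_moment (k + 1) R p hp hp1 hn0 (by omega) hR1 hm
  set K : ℝ := 100 * Real.exp 128 * R with hK
  have hKpos : 0 < K := by positivity
  have hmeas : Measurable fun ω => trace (M ω ^ (2 * (k + 1))) := by
    simp only [trace_walk]
    refine Finset.measurable_sum _ fun w _ => ?_
    by_cases hw : w 0 = w (Fin.last (2 * (k + 1)))
    · simp only [hw, if_true]; exact Finset.measurable_prod _ fun t _ => h.meas _ _
    · simp only [hw, if_false]; exact measurable_const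
  have hInteg : Integrable (fun ω => trace (M ω ^ (2 * (k + 1)))) μ := by
    simp only [trace_walk]
    refine integrable_finsetSum _ fun w _ => ?_
    by_cases hw : w 0 = w (Fin.last (2 * (k + 1)))
    · simp only [hw, if_true]; exact h.int_prod w
    · simp [hw]
  have hsym : ∀ ω, (M ω).IsSymm := fun ω => by ext i j; exact h.symm ω j i
  refine ⟨{ω | trace (M ω ^ (2 * (k + 1))) < (K * Real.exp 3) ^ (k + 1)},
    measurableSet_lt hmeas measurable_const, ?_, ?_⟩
  · have h2 := mul_meas_ge_le_integral_of_nonneg (μ := μ)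
      (f := fun ω => trace (M ω ^ (2 * (k + 1))))
      (Filter.Eventually.of_forall fun ω =>
        le_trans (by positivity) (norm_pow_le_trace (M ω) (hsym ω) k)) hInteg
      ((K * Real.exp 3) ^ (k + 1))
    have h3 : {ω | trace (M ω ^ (2 * (k + 1))) < (K * Real.exp 3) ^ (k + 1)}ᶜ =
        {ω | (K * Real.exp 3) ^ (k + 1) ≤ trace (M ω ^ (2 * (k + 1)))} := by
      ext ω; simp
    rw [h3]
    have h4 : (n : ℝ) ^ 3 ≤ Real.exp 3 ^ (k + 1) := by
      have : (n : ℝ) = Real.exp (Real.log n) := (Real.exp_log hnpos).symm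
      rw [this, ← Real.exp_nat_mul, ← Real.exp_nat_mul]
      refine Real.exp_le_exp.mpr ?_
      push_cast at hk1 ⊢; linarith
    have h5 := h2.trans h1
    rw [mul_pow] at h5
    have hKk : 0 < K ^ (k + 1) := by positivity
    rw [← mul_pow] at h5
    set x := μ.real {ω | (K * Real.exp 3) ^ (k + 1) ≤ trace (M ω ^ (2 * (k + 1)))}
    have hx : 0 ≤ x := measureReal_nonneg
    have h6 : K ^ (k + 1) * (Real.exp 3 ^ (k + 1) * x) ≤ K ^ (k + 1) * (2 * n) := by
      calc _ = (K * Real.exp 3) ^ (k + 1) * x := by rw [mul_pow]; ring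
        _ ≤ 2 * n * K ^ (k + 1) := h5
        _ = _ := by ring
    have h7 := le_of_mul_le_mul_left h6 hKk
    have h8 : (n : ℝ) ^ 3 * x ≤ 2 * n := (mul_le_mul_of_nonneg_right h4 hx).trans h7
    rw [le_div_iff₀ (by positivity)]
    have h9 : (n : ℝ) * (x * n ^ 2) ≤ n * 2 := by linarith [show (n : ℝ) * (x * n ^ 2) = n ^ 3 * x by ring]
    exact le_of_mul_le_mul_left h9 hnpos
  · intro ω hω
    simp only [Set.mem_ofPred_eq] at hω
    have h2 := (norm_pow_le_trace (M ω) (hsym ω) k).trans hω.le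
    rw [pow_mul] at h2
    have h3 := le_of_pow_le_pow_left₀ (Nat.succ_ne_zero k) (by positivity) h2
    refine h3.trans ?_
    rw [hK]
    calc 100 * Real.exp 128 * R * Real.exp 3 = 100 * Real.exp 128 * Real.exp 3 * R := by ring
      _ ≤ 100 * Real.exp 128 * Real.exp 3 * ((1 + 3 / c) * (n * p)) := by gcongr
      _ = _ := by ring


lemma adj_int {n : ℕ} {Ω : Type} [MeasurableSpace Ω] {μ : Measure Ω} [IsProbabilityMeasure μ]
    {P : Matrix (Fin n) (Fin n) ℝ} {A : Ω → Matrix (Fin n) (Fin n) ℝ} (hP : IsProbMatrix P)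
    (hA : IsAdjacencyModel μ P A) (q : Ed n) (f : ℝ → ℝ) :
    ∫ ω, f (A ω q.1.1 q.1.2) ∂μ = P q.1.1 q.1.2 * f 1 + (1 - P q.1.1 q.1.2) * f 0 := by
  obtain ⟨-, -, h01, hmeas, hlaw, -⟩ := hA
  set S := {ω | A ω q.1.1 q.1.2 = 1} with hS
  have hSm : MeasurableSet S := (hmeas q.1.1 q.1.2) (measurableSet_singleton 1)
  have h1 : ∀ ω, f (A ω q.1.1 q.1.2) = f 0 + S.indicator (fun _ => f 1 - f 0) ω := by
    intro ω
    rcases h01 ω q.1.1 q.1.2 with h | h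
    · have : ω ∉ S := by rw [hS, Set.mem_ofPred_eq, h]; norm_num
      rw [Set.indicator_of_notMem this, h]; simp
    · have : ω ∈ S := h
      rw [Set.indicator_of_mem this, h]; simp
  simp only [h1]
  rw [integral_add (integrable_const _) ((integrable_const _).indicator hSm), integral_const,
    integral_indicator_const _ hSm]
  have h2 : μ.real S = P q.1.1 q.1.2 := by
    rw [Measure.real, hlaw _ _ q.2, ENNReal.toReal_ofReal (hP.2.1 _ _)]
  rw [h2]
  simp; ring

lemma le_pstar {n : ℕ} (P : Matrix (Fin n) (Fin n) ℝ) (i j : Fin n) : P i j ≤ pstar P := by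
  refine (le_ciSup (Set.finite_range (fun j => P i j)).bddAbove j).trans ?_
  exact le_ciSup (f := fun i => ⨆ j, P i j) (Set.finite_range _).bddAbove i

lemma adj_RS {n : ℕ} {Ω : Type} [MeasurableSpace Ω] {μ : Measure Ω} [IsProbabilityMeasure μ]
    {P : Matrix (Fin n) (Fin n) ℝ} {A : Ω → Matrix (Fin n) (Fin n) ℝ} (hP : IsProbMatrix P)
    (hA : IsAdjacencyModel μ P A) : RS μ (fun ω => A ω - P) where
  symm := by
    intro ω i j
    rw [Matrix.sub_apply, Matrix.sub_apply, (hA.1 ω).apply j i, hP.1.apply j i]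
  diag := by intro ω i; rw [Matrix.sub_apply, hA.2.1, hP.2.2.2, sub_zero]
  bdd := by
    intro ω i j
    have h1 := hP.2.1 i j
    have h2 := hP.2.2.1 i j
    rw [Matrix.sub_apply]
    rcases hA.2.2.1 ω i j with h | h <;> rw [h, abs_le] <;> constructor <;> linarith
  meas := fun i j => (hA.2.2.2.1 i j).sub_const _
  indep := by
    exact hA.2.2.2.2.2.comp (fun q x => x - P q.1.1 q.1.2) (fun q => by fun_prop)
  mean := by
    intro q
    have := adj_int hP hA q (fun x => x - P q.1.1 q.1.2)
    simp only [Matrix.sub_apply]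
    rw [this]; ring

lemma adj_moment {n : ℕ} {Ω : Type} [MeasurableSpace Ω] {μ : Measure Ω} [IsProbabilityMeasure μ]
    {P : Matrix (Fin n) (Fin n) ℝ} {A : Ω → Matrix (Fin n) (Fin n) ℝ} (hP : IsProbMatrix P)
    (hA : IsAdjacencyModel μ P A) (q : Ed n) (m : ℕ) (hm : 2 ≤ m) :
    |∫ ω, ((fun ω => A ω - P) ω q.1.1 q.1.2) ^ m ∂μ| ≤ pstar P := by
  have h := adj_int hP hA q (fun x => (x - P q.1.1 q.1.2) ^ m)
  simp only [Matrix.sub_apply]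
  rw [h]
  refine le_trans ?_ (le_pstar P q.1.1 q.1.2)
  have h1 := hP.2.1 q.1.1 q.1.2
  have h2 := hP.2.2.1 q.1.1 q.1.2
  set x := P q.1.1 q.1.2
  refine (abs_add_le _ _).trans ?_
  rw [abs_mul, abs_mul, abs_pow, abs_pow, abs_of_nonneg h1, abs_of_nonneg (by linarith : 0 ≤ 1 - x),
    zero_sub, abs_neg, abs_of_nonneg h1]
  have h3 : (1 - x) ^ m ≤ (1 - x) ^ 1 := pow_le_pow_of_le_one (by linarith) (by linarith) (by omega)
  have h4 : x ^ m ≤ x ^ 2 := pow_le_pow_of_le_one h1 h2 hm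
  calc _ ≤ x * (1 - x) ^ 1 + (1 - x) * x ^ 2 := by
        have : 0 ≤ 1 - x := by linarith
        gcongr
    _ ≤ x := by nlinarith [mul_nonneg h1 (sq_nonneg x)]

lemma exp_bd (x : ℝ) : Real.exp x - 1 - x ≤ x ^ 2 * Real.exp |x| := by
  have h1 : 1 ≤ Real.exp |x| := Real.one_le_exp (abs_nonneg x)
  by_cases hx : |x| ≤ 1
  · have h := (le_abs_self _).trans (Real.abs_exp_sub_one_sub_id_le hx)
    nlinarith [sq_nonneg x]
  · push Not at hx
    have h2 : 1 ≤ x ^ 2 := by rw [← sq_abs]; nlinarith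
    rcases le_or_gt 0 x with h0 | h0
    · rw [abs_of_nonneg h0] at *
      nlinarith [Real.exp_pos x]
    · rw [abs_of_neg h0] at *
      have h3 : Real.exp x ≤ 1 := Real.exp_le_one_iff.mpr h0.le
      nlinarith

/-- Zero out row and column `m`. -/
def zr {n : ℕ} (m : Fin n) (B : Matrix (Fin n) (Fin n) ℝ) : Matrix (Fin n) (Fin n) ℝ :=
  fun i j => if i = m ∨ j = m then 0 else B i j

lemma bern_mgf (x a : ℝ) (hx : 0 ≤ x) (hx1 : x ≤ 1) :
    x * Real.exp (a * (1 - x)) + (1 - x) * Real.exp (a * (0 - x)) ≤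
      Real.exp (x * (a ^ 2 * Real.exp |a|)) := by
  have h1 := exp_bd (a * (1 - x))
  have h2 := exp_bd (a * (0 - x))
  have e1 : Real.exp |a * (1 - x)| ≤ Real.exp |a| := by
    apply Real.exp_le_exp.mpr
    rw [abs_mul, abs_of_nonneg (by linarith : 0 ≤ 1 - x)]
    nlinarith [abs_nonneg a]
  have e2 : Real.exp |a * (0 - x)| ≤ Real.exp |a| := by
    apply Real.exp_le_exp.mpr
    rw [abs_mul, zero_sub, abs_neg, abs_of_nonneg hx]
    nlinarith [abs_nonneg a]
  have h1' : Real.exp (a * (1 - x)) ≤ 1 + a * (1 - x) + (a * (1 - x)) ^ 2 * Real.exp |a| := by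
    have := mul_le_mul_of_nonneg_left e1 (sq_nonneg (a * (1 - x)))
    linarith
  have h2' : Real.exp (a * (0 - x)) ≤ 1 + a * (0 - x) + (a * (0 - x)) ^ 2 * Real.exp |a| := by
    have := mul_le_mul_of_nonneg_left e2 (sq_nonneg (a * (0 - x)))
    linarith
  have h3 := mul_le_mul_of_nonneg_left h1' hx
  have h4 := mul_le_mul_of_nonneg_left h2' (by linarith : 0 ≤ 1 - x)
  have h5 := Real.add_one_le_exp (x * (a ^ 2 * Real.exp |a|))
  have h6 : 0 ≤ a ^ 2 * Real.exp |a| := by positivity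
  have h7 : x * (1 - x) * (a ^ 2 * Real.exp |a|) ≤ x * (a ^ 2 * Real.exp |a|) := by
    apply mul_le_mul_of_nonneg_right _ h6
    nlinarith
  nlinarith

/-- Edge coefficients of the linear functional `∑ j, w j * E m j`. -/
def ecf {n : ℕ} (m : Fin n) (w : Fin n → ℝ) (q : Ed n) : ℝ :=
  (if q.1.1 = m then w q.1.2 else 0) + (if q.1.2 = m then w q.1.1 else 0)

lemma ecf_sum {n : ℕ} (m : Fin n) (w : Fin n → ℝ) (B : Matrix (Fin n) (Fin n) ℝ)
    (hs : ∀ i j, B i j = B j i) (hd : ∀ i, B i i = 0) :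
    ∑ j, w j * B m j = ∑ q, ecf m w q * B q.1.1 q.1.2 := by
  have h := quad_upper B hs hd (EuclideanSpace.single m 1) (WithLp.toLp 2 w)
  have h2 : inner ℝ (EuclideanSpace.single m (1:ℝ)) (cl B (WithLp.toLp 2 w)) = ∑ j, w j * B m j := by
    rw [EuclideanSpace.inner_single_left, cl_apply]
    simp [mul_comm]
  rw [← h2, h]
  refine Finset.sum_congr rfl fun q _ => ?_
  congr 1
  simp [ecf]

lemma ecf_abs {n : ℕ} (m : Fin n) (w : Fin n → ℝ) (b : ℝ) (hb : ∀ j, |w j| ≤ b) (q : Ed n) :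
    |ecf m w q| ≤ b := by
  have h0 : 0 ≤ b := (abs_nonneg _).trans (hb m)
  have hq := q.2
  unfold ecf
  split_ifs with h1 h2 h2
  · rw [h1, h2] at hq; exact absurd hq (lt_irrefl _)
  · simpa using hb _
  · simpa using hb _
  · simpa using h0

lemma ecf_sq {n : ℕ} (m : Fin n) (w : Fin n → ℝ) :
    ∑ q, (ecf m w q) ^ 2 ≤ 2 * ∑ j, (w j) ^ 2 := by
  have h1 : ∀ q : Ed n, (ecf m w q) ^ 2 =
      (fun q : Fin n × Fin n => (if q.1 = m then (w q.2) ^ 2 else 0) +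
        (if q.2 = m then (w q.1) ^ 2 else 0)) q.1 := by
    intro q
    have hq := q.2
    unfold ecf
    split_ifs with h1 h2 h2
    · rw [h1, h2] at hq; exact absurd hq (lt_irrefl _)
    all_goals simp [h1, h2]
  simp only [h1]
  refine (sum_ed_le (fun q : Fin n × Fin n => (if q.1 = m then (w q.2) ^ 2 else 0) +
        (if q.2 = m then (w q.1) ^ 2 else 0)) fun q => ?_).trans ?_
  · refine add_nonneg ?_ ?_ <;> split_ifs <;> positivity
  rw [Finset.sum_add_distrib, Fintype.sum_prod_type, Fintype.sum_prod_type_right]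
  simp [two_mul]

lemma row_mgf {n : ℕ} {Ω : Type} [MeasurableSpace Ω] {μ : Measure Ω} [IsProbabilityMeasure μ]
    {P : Matrix (Fin n) (Fin n) ℝ} {A : Ω → Matrix (Fin n) (Fin n) ℝ} (hP : IsProbMatrix P)
    (hA : IsAdjacencyModel μ P A) (m : Fin n) (ω0 : Ω) (w : Fin n → ℝ) (b : ℝ)
    (hb : ∀ j, |w j| ≤ b) (T : ℝ) :
    μ.real {ω | zr m (A ω) = zr m (A ω0) ∧ T ≤ ∑ j, w j * (A ω - P) m j} ≤
      μ.real {ω | zr m (A ω) = zr m (A ω0)} *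
        Real.exp (pstar P * (2 * ∑ j, (w j) ^ 2) * Real.exp b - T) := by
  classical
  have hRS := adj_RS hP hA
  set k : Ed n → ℝ → ℝ := fun q x => if q.1.1 = m ∨ q.1.2 = m then 1 else
    if x = A ω0 q.1.1 q.1.2 then 1 else 0 with hk
  have hkm : ∀ q, Measurable (k q) := by
    intro q
    simp only [hk]
    split_ifs
    · fun_prop
    · exact Measurable.ite (measurableSet_singleton _) measurable_const measurable_const
  have hk01 : ∀ q x, 0 ≤ k q x ∧ k q x ≤ 1 := by
    intro q x; simp only [hk]; split_ifs <;> norm_num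
  have hind : ∀ ω, ∏ q, k q (A ω q.1.1 q.1.2) = if zr m (A ω) = zr m (A ω0) then 1 else 0 := by
    intro ω
    split_ifs with h
    · refine Finset.prod_eq_one fun q _ => ?_
      simp only [hk]
      split_ifs with h1 h2
      · rfl
      · rfl
      · have := congrFun (congrFun h q.1.1) q.1.2
        simp only [zr, h1, if_false] at this
        exact absurd this h2
    · have : ∃ q : Ed n, k q (A ω q.1.1 q.1.2) = 0 := by
        by_contra hc
        push Not at hc
        apply h
        have key : ∀ q : Ed n, ¬ (q.1.1 = m ∨ q.1.2 = m) → A ω q.1.1 q.1.2 = A ω0 q.1.1 q.1.2 := by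
          intro q hq
          have := hc q
          simp only [hk, hq, if_false] at this
          by_contra h3
          simp [h3] at this
        ext i j
        simp only [zr]
        split_ifs with hij
        · rfl
        · rcases lt_trichotomy i j with h1 | h1 | h1
          · exact key ⟨(i, j), h1⟩ hij
          · rw [h1, hA.2.1, hA.2.1]
          · rw [(hA.1 ω).apply j i, (hA.1 ω0).apply j i]
            exact key ⟨(j, i), h1⟩ (by rw [or_comm]; exact hij)
      obtain ⟨q, hq⟩ := this
      exact Finset.prod_eq_zero (Finset.mem_univ q) hq
  set S := {ω | zr m (A ω) = zr m (A ω0)} with hS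
  have hSind : ∀ ω, ∏ q, k q (A ω q.1.1 q.1.2) = S.indicator 1 ω := by
    intro ω; rw [hind, Set.indicator_apply]; rfl
  have hmA : Measurable fun ω => fun q : Ed n => A ω q.1.1 q.1.2 :=
    measurable_pi_lambda _ fun q => hA.2.2.2.1 _ _
  have hprodm : Measurable fun ω => ∏ q, k q (A ω q.1.1 q.1.2) :=
    Finset.measurable_prod _ fun q _ => (hkm q).comp (hA.2.2.2.1 _ _)
  have hSm : MeasurableSet S := by
    have : S = (fun ω => ∏ q, k q (A ω q.1.1 q.1.2)) ⁻¹' {1} := by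
      ext ω
      simp only [Set.mem_preimage, hSind, Set.mem_singleton_iff, Set.indicator_apply]
      split_ifs with h <;> simp [h]
    rw [this]; exact hprodm (measurableSet_singleton 1)
  have hZm : Measurable fun ω => ∑ j, w j * (A ω - P) m j :=
    Finset.measurable_sum _ fun j _ => ((hA.2.2.2.1 m j).sub_const _).const_mul _
  have hμS : μ.real S = ∏ q, ∫ ω, k q (A ω q.1.1 q.1.2) ∂μ := by
    rw [← hA.2.2.2.2.2.integral_fun_prod_comp (f := k) (fun q => (hA.2.2.2.1 _ _).aemeasurable)
      (fun q => (hkm q).aestronglyMeasurable)]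
    simp only [hSind]
    rw [integral_indicator_one hSm]
  set g : Ed n → ℝ → ℝ := fun q x => Real.exp (ecf m w q * (x - P q.1.1 q.1.2)) * k q x with hg
  have hgm : ∀ q, Measurable (g q) := fun q => (by fun_prop : Measurable fun x =>
    Real.exp (ecf m w q * (x - P q.1.1 q.1.2))).mul (hkm q)
  have hgZ : ∀ ω, ∏ q, g q (A ω q.1.1 q.1.2) =
      Real.exp (∑ j, w j * (A ω - P) m j) * S.indicator 1 ω := by
    intro ω
    rw [← hSind, ecf_sum m w _ (hRS.symm ω) (hRS.diag ω), Real.exp_sum, ← Finset.prod_mul_distrib]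
    rfl
  have hgI : ∫ ω, Real.exp (∑ j, w j * (A ω - P) m j) * S.indicator 1 ω ∂μ ≤
      μ.real S * Real.exp (pstar P * (2 * ∑ j, (w j) ^ 2) * Real.exp b) := by
    simp only [← hgZ]
    rw [hA.2.2.2.2.2.integral_fun_prod_comp (f := g) (fun q => (hA.2.2.2.1 _ _).aemeasurable)
      (fun q => (hgm q).aestronglyMeasurable), hμS]
    have step : ∏ q, ∫ ω, g q (A ω q.1.1 q.1.2) ∂μ ≤ ∏ q, ((∫ ω, k q (A ω q.1.1 q.1.2) ∂μ) *
        Real.exp (P q.1.1 q.1.2 * ((ecf m w q) ^ 2 * Real.exp |ecf m w q|))) := by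
      refine Finset.prod_le_prod (fun q _ => integral_nonneg fun ω =>
        mul_nonneg (Real.exp_pos _).le (hk01 _ _).1) fun q _ => ?_
      by_cases hq : q.1.1 = m ∨ q.1.2 = m
      · have h1 : k q = fun _ => 1 := by funext x; simp [hk, hq]
        simp only [hg, h1, mul_one]
        rw [adj_int hP hA q (fun x => Real.exp (ecf m w q * (x - P q.1.1 q.1.2)))]
        simpa using bern_mgf _ (ecf m w q) (hP.2.1 _ _) (hP.2.2.1 _ _)
      · have h0 : ecf m w q = 0 := by
          push Not at hq
          simp [ecf, hq.1, hq.2]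
        simp [hg, h0]
    refine step.trans ?_
    rw [Finset.prod_mul_distrib, ← Real.exp_sum]
    refine mul_le_mul_of_nonneg_left (Real.exp_le_exp.mpr ?_)
      (Finset.prod_nonneg fun q _ => integral_nonneg fun ω => (hk01 _ _).1)
    have hp0 : 0 ≤ pstar P := (hP.2.1 m m).trans (le_pstar P m m)
    calc _ ≤ ∑ q, pstar P * ((ecf m w q) ^ 2 * Real.exp b) := by
          refine Finset.sum_le_sum fun q _ => ?_
          have := ecf_abs m w b hb q
          have := le_pstar P q.1.1 q.1.2
          gcongr
      _ = pstar P * (∑ q, (ecf m w q) ^ 2) * Real.exp b := by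
          rw [← Finset.mul_sum, ← Finset.sum_mul]; ring
      _ ≤ _ := by
          have := ecf_sq m w
          gcongr
  have hInteg : Integrable (fun ω => Real.exp (∑ j, w j * (A ω - P) m j) * S.indicator 1 ω) μ := by
    refine Integrable.of_bound (C := Real.exp (∑ j, |w j| * 2))
      ((hZm.exp).mul (measurable_one.indicator hSm)).aestronglyMeasurable ?_
    refine Filter.Eventually.of_forall fun ω => ?_
    rw [norm_mul, Real.norm_eq_abs, Real.abs_exp]
    have h1 : ‖S.indicator (1 : Ω → ℝ) ω‖ ≤ 1 := by
      rw [Set.indicator_apply]; split_ifs <;> simp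
    have h2 : Real.exp (∑ j, w j * (A ω - P) m j) ≤ Real.exp (∑ j, |w j| * 2) := by
      refine Real.exp_le_exp.mpr (Finset.sum_le_sum fun j _ => (le_abs_self _).trans ?_)
      rw [abs_mul]
      exact mul_le_mul_of_nonneg_left (hRS.bdd ω m j) (abs_nonneg _)
    calc _ ≤ Real.exp (∑ j, |w j| * 2) * 1 := by gcongr
      _ = _ := mul_one _
  set D := {ω | zr m (A ω) = zr m (A ω0) ∧ T ≤ ∑ j, w j * (A ω - P) m j} with hD
  have hDm : MeasurableSet D := hSm.inter (measurableSet_le measurable_const hZm)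
  have hlow : μ.real D * Real.exp T ≤
      ∫ ω, Real.exp (∑ j, w j * (A ω - P) m j) * S.indicator 1 ω ∂μ := by
    have : μ.real D * Real.exp T = ∫ ω, D.indicator (fun _ => Real.exp T) ω ∂μ := by
      rw [integral_indicator_const _ hDm, smul_eq_mul]
    rw [this]
    refine integral_mono ((integrable_const _).indicator hDm) hInteg fun ω => ?_
    by_cases hω : ω ∈ D
    · have hS' : ω ∈ S := hω.1
      simp only [Set.indicator_of_mem hω, Set.indicator_of_mem hS', Pi.one_apply, mul_one]
      exact Real.exp_le_exp.mpr hω.2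
    · simp only [Set.indicator_of_notMem hω]
      refine mul_nonneg (Real.exp_pos _).le ?_
      rw [Set.indicator_apply]; split_ifs <;> simp
  rw [sub_eq_add_neg, Real.exp_add, ← mul_assoc, Real.exp_neg, ← div_eq_mul_inv,
    le_div_iff₀ (Real.exp_pos T)]
  exact hlow.trans hgI

lemma row_tail {n : ℕ} {Ω : Type} [MeasurableSpace Ω] {μ : Measure Ω} [IsProbabilityMeasure μ]
    {P : Matrix (Fin n) (Fin n) ℝ} {A : Ω → Matrix (Fin n) (Fin n) ℝ} (hP : IsProbMatrix P)
    (hA : IsAdjacencyModel μ P A) (m : Fin n) (F : Matrix (Fin n) (Fin n) ℝ → Fin n → ℝ)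
    (bd T : Matrix (Fin n) (Fin n) ℝ → ℝ) (δ : ℝ)
    (hb : ∀ ω j, |F (zr m (A ω)) j| ≤ bd (zr m (A ω)))
    (hδ : ∀ ω, Real.exp (pstar P * (2 * ∑ j, (F (zr m (A ω)) j) ^ 2) * Real.exp (bd (zr m (A ω)))
      - T (zr m (A ω))) ≤ δ) :
    μ.real {ω | T (zr m (A ω)) ≤ ∑ j, F (zr m (A ω)) j * (A ω - P) m j} ≤ δ := by
  classical
  have hfin : (Set.range fun ω => zr m (A ω)).Finite := by
    refine (Set.finite_range (fun (f : Fin n → Fin n → Bool) =>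
      (fun i j => if f i j then (1:ℝ) else 0 : Matrix (Fin n) (Fin n) ℝ))).subset ?_
    rintro _ ⟨ω, rfl⟩
    refine ⟨fun i j => decide (zr m (A ω) i j = 1), ?_⟩
    funext i j
    have : zr m (A ω) i j = 0 ∨ zr m (A ω) i j = 1 := by
      simp only [zr]; split_ifs
      · exact Or.inl rfl
      · exact hA.2.2.1 ω i j
    rcases this with h | h <;> simp [h]
  set R := hfin.toFinset with hR
  have hSm : ∀ B, MeasurableSet {ω | zr m (A ω) = B} := by
    intro B
    have : {ω | zr m (A ω) = B} = ⋂ i, ⋂ j, {ω | zr m (A ω) i j = B i j} := by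
      ext ω
      simp only [Set.mem_iInter, Set.mem_ofPred_eq]
      constructor
      · intro h i j; rw [h]
      · intro h; ext i j; exact h i j
    rw [this]
    refine MeasurableSet.iInter fun i => MeasurableSet.iInter fun j => ?_
    have hm : Measurable fun ω => zr m (A ω) i j := by
      simp only [zr]
      split_ifs
      · exact measurable_const
      · exact hA.2.2.2.1 i j
    exact hm (measurableSet_singleton _)
  have hsub : {ω | T (zr m (A ω)) ≤ ∑ j, F (zr m (A ω)) j * (A ω - P) m j} ⊆
      ⋃ B ∈ R, {ω | zr m (A ω) = B ∧ T B ≤ ∑ j, F B j * (A ω - P) m j} := by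
    intro ω hω
    simp only [Set.mem_iUnion]
    exact ⟨zr m (A ω), by rw [hR, Set.Finite.mem_toFinset]; exact ⟨ω, rfl⟩, rfl, hω⟩
  have hδ0 : 0 ≤ δ := by
    have : Nonempty Ω := by
      by_contra h
      rw [not_nonempty_iff] at h
      have := measure_univ (μ := μ)
      rw [Set.univ_eq_empty_iff.mpr h] at this
      simp at this
    exact (Real.exp_pos _).le.trans (hδ this.some)
  calc _ ≤ μ.real (⋃ B ∈ R, {ω | zr m (A ω) = B ∧ T B ≤ ∑ j, F B j * (A ω - P) m j}) :=
        measureReal_mono hsub (measure_ne_top _ _)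
    _ ≤ ∑ B ∈ R, μ.real {ω | zr m (A ω) = B ∧ T B ≤ ∑ j, F B j * (A ω - P) m j} :=
        measureReal_biUnion_finset_le _ _
    _ ≤ ∑ B ∈ R, μ.real {ω | zr m (A ω) = B} * δ := by
        refine Finset.sum_le_sum fun B hB => ?_
        rw [hR, Set.Finite.mem_toFinset] at hB
        obtain ⟨ω0, rfl⟩ := hB
        exact (row_mgf hP hA m ω0 _ _ (hb ω0) _).trans
          (mul_le_mul_of_nonneg_left (hδ ω0) measureReal_nonneg)
    _ = μ.real (⋃ B ∈ R, {ω | zr m (A ω) = B}) * δ := by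
        rw [measureReal_biUnion_finset _ (fun B _ => hSm B), Finset.sum_mul]
        intro B _ B' _ hBB
        refine Set.disjoint_left.mpr fun ω h1 h2 => hBB ?_
        exact h1.symm.trans h2
    _ ≤ 1 * δ := mul_le_mul_of_nonneg_right measureReal_le_one hδ0
    _ = δ := one_mul _


/-- Maximal row norm of the projection. -/
def bmax {n : ℕ} (W : Matrix (Fin n) (Fin n) ℝ) (r : ℕ) : ℝ :=
  ⨆ j, ‖cl (proj W r) (EuclideanSpace.single j 1)‖

lemma co_single {n : ℕ} (W : Matrix (Fin n) (Fin n) ℝ) (j k : Fin n) :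
    co W (EuclideanSpace.single j 1) k = W j k := by
  simp [co]

lemma nsq_proj {n : ℕ} (W : Matrix (Fin n) (Fin n) ℝ) (hW : W * Wᵀ = 1) (r : ℕ)
    (x : EuclideanSpace ℝ (Fin n)) :
    ‖cl (proj W r) x‖ ^ 2 = ∑ k : Fin n, if (k : ℕ) < r then (co W x k) ^ 2 else 0 := by
  rw [proj, nsq_conj W hW]
  refine Finset.sum_congr rfl fun k _ => ?_
  split_ifs <;> simp

lemma le_bmax {n : ℕ} (W : Matrix (Fin n) (Fin n) ℝ) (hW : W * Wᵀ = 1) (r : ℕ) (j k : Fin n)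
    (hk : (k : ℕ) < r) : |W j k| ≤ bmax W r := by
  refine le_trans ?_ (le_ciSup (Set.finite_range _).bddAbove j)
  refine abs_le_of_sq_le_sq ?_ (norm_nonneg _)
  rw [nsq_proj W hW]
  have := Finset.single_le_sum (f := fun k : Fin n =>
    if (k : ℕ) < r then (co W (EuclideanSpace.single j 1) k) ^ 2 else 0)
    (fun i _ => by split_ifs <;> positivity) (Finset.mem_univ k)
  simpa [hk, co_single] using this

lemma col_sq {n : ℕ} (W : Matrix (Fin n) (Fin n) ℝ) (hW : W * Wᵀ = 1) (k : Fin n) :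
    ∑ j, (W j k) ^ 2 = 1 := by
  have hW' : Wᵀ * W = 1 := mul_eq_one_comm.mp hW
  have := congrFun (congrFun hW' k) k
  rw [Matrix.mul_apply] at this
  simpa [sq] using this

lemma row_conc {n : ℕ} {Ω : Type} [MeasurableSpace Ω] {μ : Measure Ω} [IsProbabilityMeasure μ]
    {P : Matrix (Fin n) (Fin n) ℝ} {A : Ω → Matrix (Fin n) (Fin n) ℝ} (hP : IsProbMatrix P)
    (hA : IsAdjacencyModel μ P A) (Wf : Matrix (Fin n) (Fin n) ℝ → Matrix (Fin n) (Fin n) ℝ)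
    (hW : ∀ ω m, Wf (zr m (A ω)) * (Wf (zr m (A ω)))ᵀ = 1) (r : ℕ) (hrn : r ≤ n) (σ : ℝ)
    (hσ : 0 < σ) (hp : 0 < pstar P) (hl : 0 < Real.log n) (hn : 0 < n) :
    ∃ D : Set Ω, μ.real D ≤ 2 / (n : ℝ) ^ 2 ∧ ∀ ω, ω ∉ D → ∀ m,
      ‖cl (proj (Wf (zr m (A ω))) r) (cl (A ω - P) (EuclideanSpace.single m 1))‖ ≤
        Real.sqrt r * (4 / σ * Real.log n * bmax (Wf (zr m (A ω))) r +
          (4 / σ + 2 * σ * Real.exp σ) * Real.sqrt (pstar P * Real.log n)) := by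
  classical
  have hRS := adj_RS hP hA
  set ℓ := Real.log n with hℓ
  set u := Real.sqrt (pstar P / ℓ) with hu
  have hu0 : 0 < u := Real.sqrt_pos.mpr (by positivity)
  have hu2 : ℓ * u ^ 2 = pstar P := by
    rw [hu, Real.sq_sqrt (by positivity)]; field_simp
  have hv : Real.sqrt (pstar P * ℓ) = ℓ * u := by
    rw [← hu2, show ℓ * u ^ 2 * ℓ = (ℓ * u) ^ 2 by ring, Real.sqrt_sq (by positivity)]
  set b : Matrix (Fin n) (Fin n) ℝ → ℝ := fun B => bmax (Wf B) r with hb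
  have hb0 : ∀ B, 0 ≤ b B := fun B => Real.iSup_nonneg fun j => norm_nonneg _
  set θ : Matrix (Fin n) (Fin n) ℝ → ℝ := fun B => σ / (b B + u) with hθ
  have hbu : ∀ B, 0 < b B + u := fun B => by have := hb0 B; linarith
  have hθ0 : ∀ B, 0 < θ B := fun B => div_pos hσ (hbu B)
  have hθb : ∀ B, θ B * (b B + u) = σ := fun B => div_mul_cancel₀ _ (hbu B).ne'
  set T0 : Matrix (Fin n) (Fin n) ℝ → ℝ := fun B => 4 / σ * ℓ * b B +
    (4 / σ + 2 * σ * Real.exp σ) * (ℓ * u) with hT0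
  have hT0' : ∀ B, 0 ≤ T0 B := fun B => by have := hb0 B; positivity
  have key : ∀ (m : Fin n) (k : Fin r) (ε : ℝ), |ε| = 1 →
      μ.real {ω | θ (zr m (A ω)) * T0 (zr m (A ω)) ≤ ∑ j, (ε * θ (zr m (A ω)) *
        Wf (zr m (A ω)) j (Fin.castLE hrn k)) * (A ω - P) m j} ≤ Real.exp (-(4 * ℓ)) := by
    intro m k ε hε
    refine row_tail hP hA m (fun B j => ε * θ B * Wf B j (Fin.castLE hrn k)) (fun _ => σ)
      (fun B => θ B * T0 B) _ ?_ ?_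
    · intro ω j
      set B := zr m (A ω)
      rw [abs_mul, abs_mul, hε, one_mul, abs_of_pos (hθ0 B)]
      have h1 := le_bmax (Wf B) (hW ω m) r j (Fin.castLE hrn k) (by simp)
      have h2 := hθb B
      have h3 := hθ0 B
      calc _ ≤ θ B * (b B + u) := by
            refine mul_le_mul_of_nonneg_left ?_ h3.le
            exact h1.trans (by simp only [hb]; linarith)
        _ = σ := h2
    · intro ω
      set B := zr m (A ω)
      refine Real.exp_le_exp.mpr ?_
      have h1 : ∑ j, (ε * θ B * Wf B j (Fin.castLE hrn k)) ^ 2 = θ B ^ 2 := by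
        have : ε ^ 2 = 1 := by rw [← sq_abs, hε]; norm_num
        simp only [mul_pow, this, one_mul]
        rw [← Finset.mul_sum, col_sq _ (hW ω m), mul_one]
      simp only [h1]
      have h2 : θ B * T0 B = 4 * ℓ + 2 * σ * Real.exp σ * (ℓ * u) * θ B := by
        have : θ B * T0 B = 4 / σ * ℓ * (θ B * (b B + u)) + 2 * σ * Real.exp σ * (ℓ * u) * θ B := by
          simp only [hT0]; ring
        rw [this, hθb]; field_simp
      have h3 : u * θ B ≤ σ := by
        rw [← hθb B]; nlinarith [hb0 B, hθ0 B]
      have h4 : pstar P * (2 * θ B ^ 2) * Real.exp σ ≤ 2 * σ * Real.exp σ * (ℓ * u) * θ B := by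
        rw [← hu2]
        have h5 : ℓ * u * θ B * (u * θ B) ≤ ℓ * u * θ B * σ :=
          mul_le_mul_of_nonneg_left h3 (by have := hθ0 B; positivity)
        have h6 := mul_le_mul_of_nonneg_right h5 (Real.exp_pos σ).le
        nlinarith
      linarith
  set Ev : (Fin n × Fin r) × Bool → Set Ω := fun x =>
    {ω | θ (zr x.1.1 (A ω)) * T0 (zr x.1.1 (A ω)) ≤ ∑ j, ((if x.2 then 1 else -1) *
      θ (zr x.1.1 (A ω)) * Wf (zr x.1.1 (A ω)) j (Fin.castLE hrn x.1.2)) * (A ω - P) x.1.1 j} with hEv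
  refine ⟨⋃ x, Ev x, ?_, ?_⟩
  · calc μ.real (⋃ x, Ev x) ≤ ∑ x, μ.real (Ev x) := measureReal_iUnion_fintype_le _
      _ ≤ ∑ x : (Fin n × Fin r) × Bool, Real.exp (-(4 * ℓ)) := by
          refine Finset.sum_le_sum fun x _ => key x.1.1 x.1.2 _ ?_
          split_ifs <;> simp
      _ = (n * r * 2 : ℝ) * Real.exp (-(4 * ℓ)) := by
          simp
      _ ≤ (n * n * 2 : ℝ) * ((n : ℝ) ^ 4)⁻¹ := by
          have : Real.exp (-(4 * ℓ)) = ((n : ℝ) ^ 4)⁻¹ := by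
            rw [Real.exp_neg, show (4 : ℝ) * ℓ = ((4 : ℕ) : ℝ) * ℓ by norm_num, Real.exp_nat_mul, hℓ,
              Real.exp_log (by positivity)]
          rw [this]
          gcongr
      _ = 2 / (n : ℝ) ^ 2 := by
          have : (n : ℝ) ≠ 0 := by positivity
          field_simp
  · intro ω hω m
    simp only [Set.mem_iUnion, not_exists] at hω
    set B := zr m (A ω) with hB
    set ξ := cl (A ω - P) (EuclideanSpace.single m 1) with hξ
    have hξj : ∀ j, ξ j = (A ω - P) m j := by
      intro j
      rw [hξ, cl_apply]
      simp only [PiLp.single_apply, mul_ite, mul_one, mul_zero, Finset.sum_ite_eq', Finset.mem_univ,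
        if_true]
      exact hRS.symm ω j m
    have hco : ∀ k : Fin n, (k : ℕ) < r → (co (Wf B) ξ k) ^ 2 ≤ T0 B ^ 2 := by
      intro k hk
      have hsum : ∀ ε : ℝ, ∑ j, (ε * θ B * Wf B j k) * (A ω - P) m j = ε * (θ B * co (Wf B) ξ k) := by
        intro ε
        rw [co, Finset.mul_sum, Finset.mul_sum]
        refine Finset.sum_congr rfl fun j _ => ?_
        rw [hξj]; ring
      have h1 := hω ((m, ⟨k, hk⟩), true)
      have h2 := hω ((m, ⟨k, hk⟩), false)
      simp only [hEv, Set.mem_ofPred_eq, not_le, if_true] at h1 h2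
      have hcast : Fin.castLE hrn ⟨k, hk⟩ = k := rfl
      rw [hcast, ← hB, hsum] at h1 h2
      simp only [Bool.false_eq_true, if_false] at h2
      have h3 := lt_of_mul_lt_mul_left (by linarith : θ B * co (Wf B) ξ k < θ B * T0 B) (hθ0 B).le
      have h4 := lt_of_mul_lt_mul_left (by linarith : θ B * (-co (Wf B) ξ k) < θ B * T0 B) (hθ0 B).le
      nlinarith
    refine abs_le_of_sq_le_sq' ?_ (by rw [hv]; exact mul_nonneg (Real.sqrt_nonneg _) (hT0' B)) |>.2
    rw [nsq_proj _ (hW ω m), hv, mul_pow, Real.sq_sqrt (by positivity)]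
    change _ ≤ (r : ℝ) * (T0 B) ^ 2
    calc _ ≤ ∑ k : Fin n, if (k : ℕ) < r then T0 B ^ 2 else 0 := by
          refine Finset.sum_le_sum fun k _ => ?_
          split_ifs with hk
          · exact hco k hk
          · exact le_rfl
      _ = (r : ℝ) * T0 B ^ 2 := by
          rw [Fin.sum_univ_eq_sum_range (fun k => if k < r then T0 B ^ 2 else 0) n,
            ← Finset.sum_filter]
          have : (Finset.range n).filter (· < r) = Finset.range r := by
            ext x; simp; omega
          rw [this]; simp


lemma SpecProj.mono {n : ℕ} {A Q : EuclideanSpace ℝ (Fin n) →L[ℝ] EuclideanSpace ℝ (Fin n)}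
    {a b a' b' : ℝ} (h : SpecProj A Q a b) (ha : a' ≤ a) (hb : b ≤ b') : SpecProj A Q a' b' :=
  ⟨h.comm, h.idem, h.nQ, h.nQ',
    fun x => (mul_le_mul_of_nonneg_right ha (norm_nonneg _)).trans (h.lower x), h.upper.trans hb⟩

/-- Deterministic leave-one-out estimates. -/
lemma loo {n : ℕ} {A A' Q Q' : EuclideanSpace ℝ (Fin n) →L[ℝ] EuclideanSpace ℝ (Fin n)} {L s : ℝ}
    (hL : 0 < L) (hQ : SpecProj A Q (L / 2) (L / 4)) (hQ' : SpecProj A' Q' (L / 2) (L / 4))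
    (e am pm ξ : EuclideanSpace ℝ (Fin n)) (he : ‖e‖ ≤ 1)
    (ham : A e = am) (hA' : A' e = 0)
    (hD : ∀ v, (A - A') v = (inner ℝ am v) • e + (inner ℝ e v) • am)
    (hξ : am = pm + ξ) (hpm : ‖pm‖ ≤ s) (hamL : ‖am‖ ≤ L / 2) (hξL : ‖ξ‖ ≤ L / 16) :
    ‖Q ξ‖ ≤ 2 * ‖Q' ξ‖ + 16 / L * s * ‖ξ‖ ∧ ‖Q' * (1 - Q)‖ ≤ 4 / L * (‖Q' ξ‖ + s) ∧
    ‖Q e‖ ≤ 2 / L * (s + ‖Q ξ‖) := by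
  have hs : 0 ≤ s := (norm_nonneg _).trans hpm
  have hle1 : ∀ (R : EuclideanSpace ℝ (Fin n) →L[ℝ] EuclideanSpace ℝ (Fin n)) (v),
      ‖R‖ ≤ 1 → ‖R v‖ ≤ ‖v‖ := fun R v h => by
    have := R.le_opNorm v
    nlinarith [norm_nonneg v]
  have hQam : ‖Q am‖ ≤ s + ‖Q ξ‖ := by
    rw [hξ, map_add]
    have := hle1 Q pm hQ.nQ
    have := norm_add_le (Q pm) (Q ξ)
    linarith
  have hQ'am : ‖Q' am‖ ≤ s + ‖Q' ξ‖ := by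
    rw [hξ, map_add]
    have := hle1 Q' pm hQ'.nQ
    have := norm_add_le (Q' pm) (Q' ξ)
    linarith
  have hQe : L / 2 * ‖Q e‖ ≤ ‖Q am‖ := by
    have h1 := hQ.lower e
    have h2 : A (Q e) = Q am := by
      rw [← ham]; exact congrArg (fun T => T e) hQ.comm
    rwa [h2] at h1
  have hQ'e : Q' e = 0 := by
    have h1 := hQ'.lower e
    have h2 : A' (Q' e) = 0 := by
      have : A' (Q' e) = Q' (A' e) := congrArg (fun T => T e) hQ'.comm
      rw [this, hA', map_zero]
    rw [h2, norm_zero] at h1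
    have : ‖Q' e‖ ≤ 0 := by
      by_contra hc
      push Not at hc
      have : 0 < L / 2 * ‖Q' e‖ := by positivity
      linarith
    exact norm_le_zero_iff.mp this
  have hgen : ∀ (R S : EuclideanSpace ℝ (Fin n) →L[ℝ] EuclideanSpace ℝ (Fin n)),
      ‖S‖ ≤ 1 → ‖R * (A - A') * S‖ ≤ ‖am‖ * ‖R e‖ + ‖R am‖ := by
    intro R S hS
    refine ContinuousLinearMap.opNorm_le_bound _ (by positivity) fun v => ?_
    change ‖R ((A - A') (S v))‖ ≤ _
    rw [hD, map_add, map_smul, map_smul]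
    have hSv := hle1 S v hS
    have i1 := abs_real_inner_le_norm am (S v)
    have i2 := abs_real_inner_le_norm e (S v)
    refine (norm_add_le _ _).trans ?_
    rw [norm_smul, norm_smul, Real.norm_eq_abs, Real.norm_eq_abs]
    have j1 : |inner ℝ am (S v)| ≤ ‖am‖ * ‖v‖ :=
      i1.trans (mul_le_mul_of_nonneg_left hSv (norm_nonneg _))
    have j2 : |inner ℝ e (S v)| ≤ ‖v‖ := by
      refine i2.trans ?_
      nlinarith [norm_nonneg (S v)]
    calc _ ≤ (‖am‖ * ‖v‖) * ‖R e‖ + ‖v‖ * ‖R am‖ := by gcongr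
      _ = _ := by ring
  have hA1 : ‖Q * (1 - Q')‖ ≤ 8 / L * (s + ‖Q ξ‖) := by
    have h1 := davis_kahan hQ hQ' (by positivity)
    have h2 := hgen Q (1 - Q') hQ'.nQ'
    have h3 : ‖am‖ * ‖Q e‖ ≤ L / 2 * ‖Q e‖ := by gcongr
    have h4 : (L / 2 - L / 4) * ‖Q * (1 - Q')‖ ≤ 2 * (s + ‖Q ξ‖) := by linarith
    rw [div_mul_eq_mul_div, le_div_iff₀ hL]
    linarith
  have hA2 : ‖Q' * (1 - Q)‖ ≤ 4 / L * (‖Q' ξ‖ + s) := by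
    have h1 := davis_kahan hQ' hQ (by positivity)
    have h2 := hgen Q' (1 - Q) hQ.nQ'
    rw [hQ'e, norm_zero, mul_zero, zero_add] at h2
    have h3 : Q' * (A' - A) * (1 - Q) = -(Q' * (A - A') * (1 - Q)) := by
      simp only [mul_sub, sub_mul]; abel
    rw [h3, norm_neg] at h1
    rw [div_mul_eq_mul_div, le_div_iff₀ hL]
    linarith
  refine ⟨?_, hA2, ?_⟩
  · have h1 : Q ξ = Q (Q' ξ) + (Q * (1 - Q')) ξ := by
      change _ = _ + Q (ξ - Q' ξ)
      rw [map_sub]; abel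
    have h2 := hle1 Q (Q' ξ) hQ.nQ
    have h3 := (Q * (1 - Q')).le_opNorm ξ
    have h4 := norm_add_le (Q (Q' ξ)) ((Q * (1 - Q')) ξ)
    rw [← h1] at h4
    have h5 : ‖Q * (1 - Q')‖ * ‖ξ‖ ≤ 8 / L * (s + ‖Q ξ‖) * ‖ξ‖ := by gcongr
    have h6 : 8 / L * ‖Q ξ‖ * ‖ξ‖ ≤ 1 / 2 * ‖Q ξ‖ := by
      have : 8 / L * ‖ξ‖ ≤ 1 / 2 := by
        rw [div_mul_eq_mul_div, div_le_iff₀ hL]; linarith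
      nlinarith [norm_nonneg (Q ξ)]
    have h7 : 16 / L * s * ‖ξ‖ = 2 * (8 / L * s * ‖ξ‖) := by ring
    rw [h7]
    nlinarith
  · rw [div_mul_eq_mul_div, le_div_iff₀ hL]
    linarith

/-- Closing the leave-one-out loop. -/
lemma loop_close {n : ℕ} [NeZero n] (a b y z : Fin n → ℝ) (L s t D1 D2 g : ℝ) (hL : 0 < L)
    (hs : 0 ≤ s) (ht : 0 ≤ t) (hD1 : 0 ≤ D1) (hg : 0 ≤ g) (hD2 : 0 ≤ D2)
    (hz : ∀ m, z m ≤ 2 * a m + t)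
    (hy : ∀ j, y j ≤ 2 / L * (s + z j))
    (hb : ∀ m, ∃ j, b m ≤ y j + 4 / L * (a m + s))
    (ha : ∀ m, a m ≤ D1 * b m + D2) (hDL : D1 * (8 / L) ≤ 1 / 2)
    (hDs : D1 * (6 / L * s) ≤ g) :
    ∀ m, z m ≤ 4 * (t + g + D2) + t := by
  obtain ⟨m0, hm0⟩ := Finite.exists_max a
  have hb' : ∀ m, b m ≤ 2 / L * (3 * s + 4 * a m0 + t) := by
    intro m
    obtain ⟨j, hj⟩ := hb m
    have h1 : y j ≤ 2 / L * (s + (2 * a m0 + t)) := by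
      refine (hy j).trans ?_
      have := hz j; have := hm0 j
      gcongr; linarith
    have h2 : 4 / L * (a m + s) ≤ 4 / L * (a m0 + s) := by
      have := hm0 m
      gcongr
    have h3 : 2 / L * (3 * s + 4 * a m0 + t) = 2 / L * (s + (2 * a m0 + t)) + 4 / L * (a m0 + s) := by
      ring
    linarith
  have hDt : D1 * (2 / L) * t ≤ t := by
    have : D1 * (2 / L) ≤ 1 := by
      have h : D1 * (8 / L) = 4 * (D1 * (2 / L)) := by ring
      linarith
    nlinarith
  have ham0 : a m0 ≤ 2 * (t + g + D2) := by
    have h1 := ha m0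
    have h2 : D1 * b m0 ≤ D1 * (2 / L * (3 * s + 4 * a m0 + t)) := by gcongr; exact hb' m0
    have h3 : D1 * (2 / L * (3 * s + 4 * a m0 + t)) =
        D1 * (6 / L * s) + D1 * (8 / L) * a m0 + D1 * (2 / L) * t := by ring
    by_cases h0 : 0 ≤ a m0
    · nlinarith
    · linarith
  intro m
  have := hz m; have := hm0 m
  linarith


lemma zr_diff {n : ℕ} (m : Fin n) (A : Matrix (Fin n) (Fin n) ℝ) (hs : A.IsSymm)
    (hd : ∀ i, A i i = 0) (v : EuclideanSpace ℝ (Fin n)) :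
    (cl A - cl (zr m A)) v = (inner ℝ (cl A (EuclideanSpace.single m 1)) v) •
      (EuclideanSpace.single m 1 : EuclideanSpace ℝ (Fin n)) +
      (inner ℝ (EuclideanSpace.single m 1 : EuclideanSpace ℝ (Fin n)) v) •
        (cl A (EuclideanSpace.single m 1)) := by
  have hAm : ∀ i, cl A (EuclideanSpace.single m 1) i = A i m := by
    intro i; rw [cl_apply]; simp
  ext i
  rw [← cl_sub, cl_apply, EuclideanSpace.inner_single_left]
  simp only [PiLp.add_apply, PiLp.smul_apply, smul_eq_mul, hAm, PiLp.inner_apply, PiLp.single_apply,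
    Matrix.sub_apply, zr, map_one, one_mul]
  by_cases him : i = m
  · subst him
    simp only [true_or, if_true, sub_zero, hd, mul_zero, add_zero, mul_one]
    refine Finset.sum_congr rfl fun j _ => ?_
    rw [← hs.apply i j]; simp [mul_comm]
  · simp only [him, false_or, if_false, mul_zero, zero_add]
    rw [Finset.sum_eq_single m]
    · simp [mul_comm]
    · intro j _ hj; simp [hj]
    · simp

lemma zr_kill {n : ℕ} (m : Fin n) (A : Matrix (Fin n) (Fin n) ℝ) :
    cl (zr m A) (EuclideanSpace.single m 1) = 0 := by
  ext i; rw [cl_apply]; simp [zr]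

lemma det_main {n : ℕ} [NeZero n] {P V A W Ph : Matrix (Fin n) (Fin n) ℝ} {lam mu : Fin n → ℝ}
    (hP : IsEigenDecomp P V lam) (hAE : IsEigenDecomp A W mu) (r : ℕ) (hr : 1 ≤ r) (hrn : r < n)
    (hs : A.IsSymm) (hd : ∀ i, A i i = 0)
    (hPh : Ph = W * Matrix.diagonal (fun i : Fin n => if (i : ℕ) < r then mu i else 0) * Wᵀ)
    (W' : Fin n → Matrix (Fin n) (Fin n) ℝ) (mu' : Fin n → Fin n → ℝ)
    (hW' : ∀ m, IsEigenDecomp (zr m A) (W' m) (mu' m))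
    (L κ s lr u D1 D2 g : ℝ) (hL : 0 < L) (hκ : ‖cl (A - P)‖ ≤ κ)
    (hsP : ∀ m, ‖cl P (EuclideanSpace.single m 1)‖ ≤ s)
    (hLl : L ≤ |lam ⟨r - 1, by omega⟩|) (hlr : |lam ⟨r, hrn⟩| ≤ lr)
    (hu : ∀ m, ‖cl (proj V r) (EuclideanSpace.single m 1)‖ ≤ u)
    (hc1 : 3 * κ + 2 * s ≤ L / 8) (hc2 : lr ≤ L / 8)
    (hD1 : 0 ≤ D1) (hg : 0 ≤ g) (hD2 : 0 ≤ D2)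
    (ha : ∀ m, ‖cl (proj (W' m) r) (cl (A - P) (EuclideanSpace.single m 1))‖ ≤
      D1 * bmax (W' m) r + D2)
    (hDL : D1 * (8 / L) ≤ 1 / 2) (hDs : D1 * (6 / L * s) ≤ g) (i : Fin n) :
    ‖cl (Ph - P) (EuclideanSpace.single i 1)‖ ≤
      4 * (16 / L * s * κ + g + D2) + 16 / L * s * κ + lr + (lr + 2 * κ) * u := by
  have hκ0 : 0 ≤ κ := (norm_nonneg _).trans hκ
  have hs0 : 0 ≤ s := (norm_nonneg _).trans (hsP i)
  have hlr0 : 0 ≤ lr := (abs_nonneg _).trans hlr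
  have hu0 : 0 ≤ u := (norm_nonneg _).trans (hu i)
  set e : Fin n → EuclideanSpace ℝ (Fin n) := fun m => EuclideanSpace.single m 1 with he
  have he1 : ∀ m, ‖e m‖ = 1 := fun m => by simp [he]
  have hκ' : ‖cl A - cl P‖ ≤ κ := by rw [← cl_sub]; exact hκ
  have hξκ : ∀ m, ‖cl (A - P) (e m)‖ ≤ κ := fun m => by
    have := (cl (A - P)).le_opNorm (e m)
    rw [he1, mul_one] at this; exact this.trans hκ
  have hsum : ∀ m, cl A (e m) = cl P (e m) + cl (A - P) (e m) := fun m => by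
    rw [cl_sub]; simp
  have ham : ∀ m, ‖cl A (e m)‖ ≤ s + κ := fun m => by
    rw [hsum]; exact (norm_add_le _ _).trans (add_le_add (hsP m) (hξκ m))
  have hzr : ∀ m, ‖cl A - cl (zr m A)‖ ≤ 2 * (s + κ) := fun m => by
    refine ContinuousLinearMap.opNorm_le_bound _ (by positivity) fun v => ?_
    rw [zr_diff m A hs hd v]
    refine (norm_add_le _ _).trans ?_
    rw [norm_smul, norm_smul]
    have h1 := norm_inner_le_norm (𝕜 := ℝ) (cl A (e m)) v
    have h2 := norm_inner_le_norm (𝕜 := ℝ) (e m) v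
    rw [he1, one_mul] at h2
    have h3 := ham m
    have h4 : ‖cl A (e m)‖ * ‖v‖ ≤ (s + κ) * ‖v‖ := mul_le_mul_of_nonneg_right h3 (norm_nonneg _)
    have h5 : ‖inner ℝ (e m) v‖ * ‖cl A (e m)‖ ≤ ‖v‖ * (s + κ) :=
      mul_le_mul h2 h3 (norm_nonneg _) (norm_nonneg _)
    change ‖inner ℝ (cl A (e m)) v‖ * ‖e m‖ + ‖inner ℝ (e m) v‖ * ‖cl A (e m)‖ ≤ _
    rw [he1, mul_one]
    linarith
  have hzrP : ∀ m, ‖cl (zr m A) - cl P‖ ≤ 3 * κ + 2 * s := fun m => by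
    have : cl (zr m A) - cl P = (cl A - cl P) - (cl A - cl (zr m A)) := by abel
    rw [this]
    refine (norm_sub_le _ _).trans ?_
    have := hzr m
    linarith
  have hQP := specProj_of hP r hr hrn
  have hQ0 := specProj_of hAE r hr hrn
  have hmur : |mu ⟨r, hrn⟩| ≤ lr + κ := (weyl hAE hP _).trans (by linarith)
  have hmul : L / 2 ≤ |mu ⟨r - 1, by omega⟩| := by
    have := weyl hP hAE ⟨r - 1, by omega⟩
    rw [norm_sub_rev] at this
    linarith
  have hQ : SpecProj (cl A) (cl (proj W r)) (L / 2) (L / 4) := hQ0.mono hmul (by linarith)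
  have hQ' : ∀ m, SpecProj (cl (zr m A)) (cl (proj (W' m) r)) (L / 2) (L / 4) := fun m => by
    refine (specProj_of (hW' m) r hr hrn).mono ?_ ?_
    · have := weyl hP (hW' m) ⟨r - 1, by omega⟩
      rw [norm_sub_rev] at this
      have := hzrP m
      linarith
    · have := weyl (hW' m) hP ⟨r, hrn⟩
      have := hzrP m
      linarith
  have hloo := fun m => loo hL hQ (hQ' m) (e m) (cl A (e m)) (cl P (e m)) (cl (A - P) (e m))
    (he1 m).le rfl (zr_kill m A) (zr_diff m A hs hd) (hsum m) (hsP m)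
    ((ham m).trans (by linarith)) ((hξκ m).trans (by linarith))
  set t := 16 / L * s * κ with ht
  have ht0 : 0 ≤ t := by positivity
  have hz := loop_close (fun m => ‖cl (proj (W' m) r) (cl (A - P) (e m))‖) (fun m => bmax (W' m) r)
    (fun j => ‖cl (proj W r) (e j)‖) (fun m => ‖cl (proj W r) (cl (A - P) (e m))‖) L s t D1 D2 g hL
    hs0 ht0 hD1 hg hD2 (fun m => (hloo m).1.trans (by
      have := mul_le_mul_of_nonneg_left (hξκ m) (by positivity : 0 ≤ 16 / L * s)
      linarith)) (fun m => (hloo m).2.2) (fun m => by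
      obtain ⟨j, hj⟩ := exists_eq_ciSup_of_finite
        (f := fun j => ‖cl (proj (W' m) r) (EuclideanSpace.single j (1:ℝ))‖)
      refine ⟨j, ?_⟩
      have h1 : bmax (W' m) r = ‖cl (proj (W' m) r) (e j)‖ := hj.symm
      rw [h1]
      have h2 : cl (proj (W' m) r) (e j) = cl (proj (W' m) r) (cl (proj W r) (e j)) +
          (cl (proj (W' m) r) * (1 - cl (proj W r))) (e j) := by
        simp
      rw [h2]
      refine (norm_add_le _ _).trans (add_le_add ?_ ?_)
      · have h3 := (cl (proj (W' m) r)).le_opNorm (cl (proj W r) (e j))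
        have h4 := (hQ' m).nQ
        nlinarith [norm_nonneg (cl (proj W r) (e j))]
      · have h3 := (cl (proj (W' m) r) * (1 - cl (proj W r))).le_opNorm (e j)
        rw [he1, mul_one] at h3
        exact h3.trans (hloo m).2.1) ha hDL hDs i
  have hPh' : cl Ph = cl (proj W r) * cl A := by
    rw [← cl_mul, hPh, hAE.2.1, proj, wconj_mul W hAE.1]
    congr; ext k; split_ifs <;> simp
  have hdec : cl (Ph - P) (e i) = cl (proj W r) (cl (A - P) (e i)) -
      (1 - cl (proj W r)) ((cl P * (1 - cl (proj V r))) (e i)) -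
      ((1 - cl (proj W r)) * cl P) (cl (proj V r) (e i)) := by
    rw [cl_sub, cl_sub, hPh']
    simp
    abel
  have hn1 : ‖(1 - cl (proj W r)) ((cl P * (1 - cl (proj V r))) (e i))‖ ≤ lr := by
    have h1 := (1 - cl (proj W r)).le_opNorm ((cl P * (1 - cl (proj V r))) (e i))
    have h2 := (cl P * (1 - cl (proj V r))).le_opNorm (e i)
    rw [he1, mul_one] at h2
    have h3 := hQP.upper
    have h4 := hQ.nQ'
    calc _ ≤ _ := h1
      _ ≤ 1 * ‖(cl P * (1 - cl (proj V r))) (e i)‖ := by gcongr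
      _ ≤ lr := by rw [one_mul]; linarith
  have hn2 : ‖(1 - cl (proj W r)) * cl P‖ ≤ lr + 2 * κ := by
    have h1 : (1 - cl (proj W r)) * cl P = cl A * (1 - cl (proj W r)) -
        (1 - cl (proj W r)) * (cl A - cl P) := by
      simp only [mul_sub, sub_mul, hQ.comm, mul_one, one_mul]; abel
    rw [h1]
    refine (norm_sub_le _ _).trans ?_
    have h2 := hQ0.upper
    have h3 := norm_mul_le (1 - cl (proj W r)) (cl A - cl P)
    have h4 : ‖1 - cl (proj W r)‖ * ‖cl A - cl P‖ ≤ 1 * κ :=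
      mul_le_mul hQ.nQ' hκ' (norm_nonneg _) (by norm_num)
    linarith
  have hn3 : ‖((1 - cl (proj W r)) * cl P) (cl (proj V r) (e i))‖ ≤ (lr + 2 * κ) * u := by
    refine (ContinuousLinearMap.le_opNorm _ _).trans ?_
    exact mul_le_mul hn2 (hu i) (norm_nonneg _) (by positivity)
  change ‖cl (Ph - P) (e i)‖ ≤ _
  rw [hdec]
  refine (norm_sub_le _ _).trans ?_
  have := norm_sub_le (cl (proj W r) (cl (A - P) (e i)))
    ((1 - cl (proj W r)) ((cl P * (1 - cl (proj V r))) (e i)))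
  linarith


lemma centerH_apply {n : ℕ} (x : EuclideanSpace ℝ (Fin n)) (i : Fin n) :
    cl (centerH n) x i = x i - (n : ℝ)⁻¹ * ∑ j, x j := by
  rw [cl_apply, centerH]
  simp only [Matrix.sub_apply, Matrix.smul_apply, Matrix.of_apply, smul_eq_mul, mul_one, sub_mul,
    Finset.sum_sub_distrib, Matrix.one_apply, ite_mul, one_mul, zero_mul, Finset.sum_ite_eq,
    Finset.mem_univ, if_true, Finset.mul_sum]

lemma centerH_norm {n : ℕ} (hn : 0 < n) (x : EuclideanSpace ℝ (Fin n)) :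
    ‖cl (centerH n) x‖ ≤ ‖x‖ := by
  refine abs_le_of_sq_le_sq' ?_ (norm_nonneg _) |>.2
  have hn' : (n : ℝ) ≠ 0 := by positivity
  rw [nsq, nsq]
  simp only [centerH_apply]
  set a := (n : ℝ)⁻¹ * ∑ j, x j with ha
  have h1 : ∑ j, x j = n * a := by rw [ha]; field_simp
  have h2 : ∑ i, (x i - a) ^ 2 = ∑ i, x i ^ 2 - n * a ^ 2 := by
    have : ∀ i, (x i - a) ^ 2 = x i ^ 2 - 2 * a * x i + a ^ 2 := fun i => by ring
    simp only [this, Finset.sum_add_distrib, Finset.sum_sub_distrib, ← Finset.mul_sum, h1]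
    simp; ring
  rw [h2]
  have : 0 ≤ (n : ℝ) * a ^ 2 := by positivity
  linarith

lemma centerH_symm {n : ℕ} (i j : Fin n) : centerH n i j = centerH n j i := by
  simp only [centerH, Matrix.sub_apply, Matrix.smul_apply, Matrix.of_apply, Matrix.one_apply, eq_comm]

lemma rowNorm_eq {n : ℕ} (M : Matrix (Fin n) (Fin n) ℝ) (hM : M.IsSymm) (i : Fin n) :
    rowNorm (M * centerH n) i = ‖cl (centerH n) (cl M (EuclideanSpace.single i 1))‖ := by
  rw [rowNorm, EuclideanSpace.norm_eq]
  congr 1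
  refine Finset.sum_congr rfl fun j _ => ?_
  rw [Real.norm_eq_abs, sq_abs, cl_apply, Matrix.mul_apply]
  congr 1
  refine Finset.sum_congr rfl fun k _ => ?_
  have : cl M (EuclideanSpace.single i 1) k = M k i := by rw [cl_apply]; simp
  rw [this, centerH_symm k j, hM.apply i k, mul_comm]

lemma recov {n : ℕ} (hn : 2 ≤ n) {P Ph : Matrix (Fin n) (Fin n) ℝ} (hP : IsProbMatrix P)
    (hPh : Ph.IsSymm) (err : ℝ)
    (herr : ∀ i, ‖cl (Ph - P) (EuclideanSpace.single i 1)‖ ≤ err)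
    (hsig : 2 * err + pstar P < hSignal P) :
    ExactRecovery (fun i => rowNorm (Ph * centerH n) i) (coreER P) := by
  have hclose : ∀ i, |rowNorm (Ph * centerH n) i - rowNorm (P * centerH n) i| ≤ err := by
    intro i
    rw [rowNorm_eq _ hPh, rowNorm_eq _ hP.1]
    refine (abs_norm_sub_norm_le _ _).trans ?_
    rw [← map_sub]
    refine (centerH_norm (by omega) _).trans ?_
    have := herr i
    rw [cl_sub] at this
    exact this
  have hper : ∀ j, j ∉ coreER P → rowNorm (P * centerH n) j ≤ pstar P := by
    intro j hj
    have hj' : j ∈ peripheryER P := by simpa [coreER] using hj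
    simp only [peripheryER, Finset.mem_filter, Finset.mem_univ, true_and] at hj'
    have hnt : Nontrivial (Fin n) := Fin.nontrivial_iff_two_le.mpr hn
    obtain ⟨k, hk⟩ := exists_ne j
    rw [rowNorm_eq _ hP.1]
    have h1 : cl (centerH n) (cl P (EuclideanSpace.single j 1)) =
        (-(P j k)) • cl (centerH n) (EuclideanSpace.single j 1) := by
      have hrow : ∀ i, cl P (EuclideanSpace.single j 1) i = P j k - P j k * (if i = j then 1 else 0) := by
        intro i
        have : cl P (EuclideanSpace.single j 1) i = P i j := by rw [cl_apply]; simp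
        rw [this]
        split_ifs with h
        · rw [h, hP.2.2.2]; ring
        · rw [← hP.1.apply, hj' i k h hk]; ring
      have hn' : (n : ℝ) ≠ 0 := by
        have : 0 < n := by omega
        positivity
      ext i
      rw [centerH_apply, PiLp.smul_apply, centerH_apply]
      simp only [hrow, PiLp.single_apply, Finset.sum_sub_distrib, ← Finset.mul_sum,
        Finset.sum_ite_eq', Finset.mem_univ, if_true, Finset.sum_const, Finset.card_univ,
        Fintype.card_fin, smul_eq_mul, nsmul_eq_mul]
      field_simp
      ring
    rw [h1, norm_smul, norm_neg, Real.norm_eq_abs, abs_of_nonneg (hP.2.1 _ _)]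
    have h2 := centerH_norm (by omega : 0 < n) (EuclideanSpace.single j (1:ℝ))
    rw [EuclideanSpace.norm_single, norm_one] at h2
    have h3 := hP.2.1 j k
    have h4 := le_pstar P j k
    nlinarith
  intro i hi j hj
  have h1 : hSignal P ≤ rowNorm (P * centerH n) i :=
    ciInf_le (f := fun i : {i // i ∈ coreER P} => rowNorm (P * centerH n) i.1)
      (Set.finite_range _).bddBelow ⟨i, hi⟩
  have h2 := abs_le.mp (hclose i)
  have h3 := abs_le.mp (hclose j)
  have h4 := hper j hj
  simp only
  linarith

lemma prob_row {n : ℕ} {P : Matrix (Fin n) (Fin n) ℝ} (hP : IsProbMatrix P) (m : Fin n) :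
    ‖cl P (EuclideanSpace.single m 1)‖ ≤ Real.sqrt n * pstar P := by
  have hp0 : 0 ≤ pstar P := (hP.2.1 m m).trans (le_pstar P m m)
  refine abs_le_of_sq_le_sq' ?_ (by positivity) |>.2
  rw [nsq, mul_pow, Real.sq_sqrt (by positivity)]
  calc _ ≤ ∑ i : Fin n, (pstar P) ^ 2 := by
        refine Finset.sum_le_sum fun i _ => ?_
        have : cl P (EuclideanSpace.single m 1) i = P i m := by rw [cl_apply]; simp
        rw [this]
        exact pow_le_pow_left₀ (hP.2.1 _ _) (le_pstar _ _ _) 2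
    _ = _ := by simp

lemma proj_row {n : ℕ} (V : Matrix (Fin n) (Fin n) ℝ) (hV : V * Vᵀ = 1) (r : ℕ) (h : r ≤ n)
    (m : Fin n) : ‖cl (proj V r) (EuclideanSpace.single m 1)‖ ≤ twoInf (topEig V r h) := by
  refine le_trans ?_ (le_ciSup (Set.finite_range _).bddAbove m)
  refine Real.le_sqrt_of_sq_le ?_
  rw [nsq_proj V hV]
  simp only [co_single, topEig]
  have h1 : ∑ k : Fin n, (if (k : ℕ) < r then V m k ^ 2 else 0) =
      ∑ k ∈ Finset.univ.filter (fun k : Fin n => (k : ℕ) < r), V m k ^ 2 := by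
    rw [Finset.sum_filter]
  rw [h1]
  refine le_of_eq ?_
  symm
  refine Finset.sum_bij (fun (k : Fin r) _ => Fin.castLE h k) ?_ ?_ ?_ ?_
  · intro k _; simp
  · intro a _ b _ hab; simpa using hab
  · intro b hb
    simp only [Finset.mem_filter, Finset.mem_univ, true_and] at hb
    exact ⟨⟨b, hb⟩, Finset.mem_univ _, rfl⟩
  · intro k _; rfl

set_option maxHeartbeats 1600000 in
lemma numer (c₁ c₂ k K : ℝ) (hc₁ : 0 < c₁) (hc₂ : 0 < c₂) (hk : 0 < k) (hK : 0 < K) :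
    ∃ (σ Cp l₀ : ℝ), 0 < σ ∧ 0 < Cp ∧ 1 ≤ l₀ ∧ ∀ (N y R l μ₀ : ℝ), 1 ≤ N → 0 < y → y ≤ 1 → 1 ≤ R →
      l₀ ≤ l → 1 ≤ μ₀ → k * R * l ≤ N * y →
      let L := c₁ * N ^ 2 * y ^ 2 / R
      let s := N * y ^ 2
      let κ := K * N * y
      let lr := c₂ * (y * l)
      let u := μ₀ * (R / N)
      let D1 := R * (4 / σ * l ^ 2)
      let D2 := R * ((4 / σ + 2 * σ * Real.exp σ) * (y * l))
      let g := 24 / (σ * c₁ * k) * (R * l * y)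
      0 < L ∧ 3 * κ + 2 * s ≤ L / 8 ∧ lr ≤ L / 8 ∧ D1 * (8 / L) ≤ 1 / 2 ∧ D1 * (6 / L * s) ≤ g ∧
        4 * (16 / L * s * κ + g + D2) + 16 / L * s * κ + lr + (lr + 2 * κ) * u ≤
          Cp * (μ₀ * R * l * y) := by
  set σ := 64 / (c₁ * k ^ 2) with hσ
  have hσ0 : 0 < σ := by positivity
  set Cσ := 4 / σ + 2 * σ * Real.exp σ with hCσ
  have hCσ0 : 0 < Cσ := by positivity
  refine ⟨σ, 80 * K / c₁ + 4 * (24 / (σ * c₁ * k)) + 4 * Cσ + 2 * c₂ + 2 * K,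
    1 + 48 * K / (c₁ * k) + 32 / (c₁ * k) + 8 * c₂ / (c₁ * k ^ 2), hσ0, by positivity, ?_, ?_⟩
  · have : 0 ≤ 48 * K / (c₁ * k) + 32 / (c₁ * k) + 8 * c₂ / (c₁ * k ^ 2) := by positivity
    linarith
  intro N y R l μ₀ hN hy hy1 hR hl hμ hNy L s κ lr u D1 D2 g
  have hN0 : 0 < N := by linarith
  have hR0 : 0 < R := by linarith
  have e1 : 0 ≤ 48 * K / (c₁ * k) := by positivity
  have e2 : 0 ≤ 32 / (c₁ * k) := by positivity
  have e3 : 0 ≤ 8 * c₂ / (c₁ * k ^ 2) := by positivity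
  have hl1 : 1 ≤ l := by linarith
  have hl0 : 0 < l := by linarith
  have l1 : 48 * K ≤ c₁ * k * l := by
    have : 48 * K / (c₁ * k) ≤ l := by linarith
    rw [div_le_iff₀ (by positivity)] at this; linarith
  have l2 : 32 ≤ c₁ * k * l := by
    have : 32 / (c₁ * k) ≤ l := by linarith
    rw [div_le_iff₀ (by positivity)] at this; linarith
  have l3 : 8 * c₂ ≤ c₁ * k ^ 2 * l := by
    have : 8 * c₂ / (c₁ * k ^ 2) ≤ l := by linarith
    rw [div_le_iff₀ (by positivity)] at this; linarith
  have hNN : k * R * l ≤ N := hNy.trans (by nlinarith)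
  have hL : 0 < L := by positivity
  have a1 : κ ≤ L / 48 := by
    have h1 : 48 * K * R ≤ c₁ * (N * y) := by
      calc 48 * K * R ≤ c₁ * k * l * R := by gcongr
        _ = c₁ * (k * R * l) := by ring
        _ ≤ _ := by gcongr
    have h2 : κ * R * 48 ≤ c₁ * N ^ 2 * y ^ 2 := by
      have := mul_le_mul_of_nonneg_left h1 (by positivity : 0 ≤ N * y)
      simp only [κ]; linarith
    rw [le_div_iff₀ (by norm_num)]
    simp only [L]
    rw [le_div_iff₀ hR0]; linarith
  have a2 : s ≤ L / 32 := by
    have h1 : 32 * R ≤ c₁ * N := by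
      calc 32 * R ≤ c₁ * k * l * R := by gcongr
        _ = c₁ * (k * R * l) := by ring
        _ ≤ _ := by gcongr
    have h2 : s * R * 32 ≤ c₁ * N ^ 2 * y ^ 2 := by
      have := mul_le_mul_of_nonneg_left h1 (by positivity : 0 ≤ N * y ^ 2)
      simp only [s]; linarith
    rw [le_div_iff₀ (by norm_num)]
    simp only [L]
    rw [le_div_iff₀ hR0]; linarith
  have a3 : lr ≤ L / 8 := by
    have h1 : 8 * c₂ ≤ c₁ * k * N := by
      calc 8 * c₂ ≤ c₁ * k ^ 2 * l := l3
        _ = c₁ * k * (k * 1 * l) := by ring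
        _ ≤ c₁ * k * (k * R * l) := by gcongr
        _ ≤ _ := by gcongr
    have h2 : k * (lr * R * 8) ≤ k * (c₁ * N ^ 2 * y ^ 2) := by
      calc k * (lr * R * 8) = 8 * c₂ * y * (k * R * l) := by simp only [lr]; ring
        _ ≤ c₁ * k * N * y * (N * y) := by gcongr
        _ = _ := by ring
    have h3 := le_of_mul_le_mul_left h2 hk
    rw [le_div_iff₀ (by norm_num)]
    simp only [L]
    rw [le_div_iff₀ hR0]; linarith
  have b1 : D1 * (8 / L) ≤ 1 / 2 := by
    have : D1 * (8 / L) = (k * R * l) ^ 2 / (N * y) ^ 2 / 2 := by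
      simp only [D1, L, hσ]; field_simp; ring
    rw [this]
    have h1 : (k * R * l) ^ 2 / (N * y) ^ 2 ≤ 1 := by
      rw [div_le_one (by positivity)]; gcongr
    linarith
  have b2 : D1 * (6 / L * s) ≤ g := by
    have : D1 * (6 / L * s) = 24 / (σ * c₁ * k) * (R * l * (k * R * l / N)) := by
      simp only [D1, L, s]; field_simp; ring
    rw [this]
    have h1 : k * R * l / N ≤ y := by rw [div_le_iff₀ hN0]; linarith
    simp only [g]; gcongr
  have c1 : 16 / L * s * κ = 16 * K / c₁ * (R * y) := by
    simp only [L, s, κ]; field_simp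
  have hX1 : R * y ≤ μ₀ * R * l * y := by
    have : 1 ≤ μ₀ * l := by nlinarith
    nlinarith [mul_pos hR0 hy]
  have hX2 : R * l * y ≤ μ₀ * R * l * y := by
    nlinarith [mul_pos (mul_pos hR0 hl0) hy]
  have hX3 : y * l ≤ μ₀ * R * l * y := by
    have : 1 ≤ μ₀ * R := by nlinarith
    nlinarith [mul_pos hl0 hy]
  have d1 : (lr + 2 * κ) * u ≤ (c₂ + 2 * K) * (μ₀ * R * l * y) := by
    have : (lr + 2 * κ) * u = c₂ * (μ₀ * R * l * y) / N + 2 * K * (μ₀ * (R * y)) := by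
      simp only [lr, κ, u]; field_simp
    rw [this]
    have h1 : c₂ * (μ₀ * R * l * y) / N ≤ c₂ * (μ₀ * R * l * y) := div_le_self (by positivity) hN
    have h2 : μ₀ * (R * y) ≤ μ₀ * R * l * y := by
      have : 0 < μ₀ * (R * y) := by positivity
      nlinarith
    have h3 : 2 * K * (μ₀ * (R * y)) ≤ 2 * K * (μ₀ * R * l * y) := by gcongr
    linarith
  refine ⟨hL, by linarith, a3, b1, b2, ?_⟩
  rw [c1]
  set X := μ₀ * R * l * y
  have f1 : 16 * K / c₁ * (R * y) ≤ 16 * K / c₁ * X := by gcongr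
  have f2 : g ≤ 24 / (σ * c₁ * k) * X := by simp only [g]; gcongr
  have f3 : D2 ≤ Cσ * X := by
    simp only [D2]
    calc _ = Cσ * (R * l * y) := by ring
      _ ≤ _ := by gcongr
  have f4 : lr ≤ c₂ * X := by simp only [lr]; gcongr
  have : 80 * K / c₁ * X = 5 * (16 * K / c₁ * X) := by ring
  linarith


lemma eig_exists {n : ℕ} (B : Matrix (Fin n) (Fin n) ℝ) (hB : B.IsSymm) :
    ∃ (W : Matrix (Fin n) (Fin n) ℝ) (mu : Fin n → ℝ), IsEigenDecomp B W mu := by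
  have hH : B.IsHermitian := by
    rw [Matrix.IsHermitian, Matrix.conjTranspose_eq_transpose_of_trivial]; exact hB
  set U : Matrix (Fin n) (Fin n) ℝ := (hH.eigenvectorUnitary : Matrix (Fin n) (Fin n) ℝ) with hU
  have hUU : U * Uᵀ = 1 := by
    have := Unitary.coe_mul_star_self hH.eigenvectorUnitary
    rw [Unitary.coe_star, Matrix.star_eq_conjTranspose,
      Matrix.conjTranspose_eq_transpose_of_trivial] at this
    exact this
  have hsp : B = U * diagonal hH.eigenvalues * Uᵀ := by
    have := hH.spectral_theorem
    rw [Unitary.conjStarAlgAut_apply] at this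
    rw [Matrix.star_eq_conjTranspose, Matrix.conjTranspose_eq_transpose_of_trivial] at this
    exact this
  set s := Tuple.sort (fun i => - |hH.eigenvalues i|) with hs
  have hmono := Tuple.monotone_sort (fun i => - |hH.eigenvalues i|)
  refine ⟨U.submatrix id s, hH.eigenvalues ∘ s, ?_, ?_, ?_⟩
  · rw [Matrix.transpose_submatrix, Matrix.submatrix_mul_equiv, hUU]; simp
  · have : diagonal (hH.eigenvalues ∘ s) = (diagonal hH.eigenvalues).submatrix s s := by
      rw [Matrix.submatrix_diagonal_equiv]
    rw [this, Matrix.transpose_submatrix, Matrix.submatrix_mul_equiv, Matrix.submatrix_mul_equiv,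
      ← hsp]; simp
  · intro i j hij
    have := hmono hij
    simp only [Function.comp] at this ⊢
    linarith


set_option maxHeartbeats 1600000 in
/-- strong consistency of Algorithm 1 under the ER-type model. -/
theorem er_strong_consistency
    (c₁ c₂ c₃ c₄ : ℝ) (hc₁ : 0 < c₁) (hc₂ : 0 < c₂) (hc₃ : 0 < c₃) (hc₄ : 0 < c₄) :
    ∃ (γ C : ℝ) (N₀ : ℕ), 0 < γ ∧ 0 < C ∧
      ∀ (n : ℕ) (hN : N₀ ≤ n) (hn : 2 ≤ n)
        (P : Matrix (Fin n) (Fin n) ℝ) (hP : IsProbMatrix P)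
        (r : ℕ) (hr1 : 1 ≤ r) (hrn : r < n)
        (V : Matrix (Fin n) (Fin n) ℝ) (lam : Fin n → ℝ)
        (hVlam : IsEigenDecomp P V lam)
        (μ₀ : ℝ) (hμ₀ : 1 ≤ μ₀)
        -- (i) approximate low-rankness
        (hlamr : c₁ * n * pstar P / Real.sqrt r ≤ |lam ⟨r - 1, by omega⟩|)
        (hlamr1 : |lam ⟨r, hrn⟩| ≤ c₂ * Real.sqrt (pstar P * Real.log n))
        -- (ii) incoherence
        (hU : twoInf (topEig V r (le_of_lt hrn)) ≤ μ₀ * Real.sqrt (r / n))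
        -- (iii) density
        (hp : c₃ * max (μ₀ ^ 2 * r * Real.log n / n) (μ₀ ^ 2 * r ^ 2 / n) ≤ pstar P)
        -- (iv) bounded eigenratio
        (hratio : |lam ⟨0, by omega⟩ / lam ⟨r - 1, by omega⟩| ≤ c₄)
        -- (v) signal strength
        (hsignal : C * (μ₀ * Real.sqrt (r * (Real.log n + r) * pstar P)
            + μ₀ ^ 2 * r * Real.sqrt (pstar P)) ≤ hSignal P)
        (Ω : Type) (_ : MeasurableSpace Ω) (μ : Measure Ω) (hμ : IsProbabilityMeasure μ)
        (A : Ω → Matrix (Fin n) (Fin n) ℝ) (hA : IsAdjacencyModel μ P A)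
        (Phat : Ω → Matrix (Fin n) (Fin n) ℝ) (hPhat : ∀ ω, IsSpecTrunc r (A ω) (Phat ω)),
        ENNReal.ofReal
            (1 - (Bconst (|lam ⟨0, by omega⟩ / lam ⟨r - 1, by omega⟩|) r + 2) * (n : ℝ) ^ (-γ)) ≤
          μ {ω | ExactRecovery (fun i => rowNorm (Phat ω * centerH n) i) (coreER P)} := by
  set K2 : ℝ := 100 * Real.exp 128 * Real.exp 3 * (1 + 3 / c₃) with hK2
  have hK2pos : 0 < K2 := by positivity
  obtain ⟨σ, Cp, l₀, hσ, hCp, hl₀, hnum⟩ := numer c₁ c₂ (Real.sqrt c₃) (Real.sqrt K2) hc₁ hc₂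
    (Real.sqrt_pos.mpr hc₃) (Real.sqrt_pos.mpr hK2pos)
  refine ⟨1, 2 * Cp + 2, ⌈Real.exp (l₀ ^ 2)⌉₊, one_pos, by positivity, ?_⟩
  intro n hN hn P hP r hr1 hrn V lam hVlam μ₀ hμ₀ hlamr hlamr1 hU hp hratio hsignal Ω _ μ hμ A hA
    Phat hPhat
  have hnpos : 0 < n := by omega
  have : NeZero n := ⟨by omega⟩
  have hnR : (0 : ℝ) < n := by exact_mod_cast hnpos
  set p := pstar P with hpdef
  set ℓ := Real.log n with hℓ
  have hr1' : (1 : ℝ) ≤ r := by exact_mod_cast hr1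
  have hlog : l₀ ^ 2 ≤ ℓ := by
    rw [hℓ, Real.le_log_iff_exp_le hnR]
    exact (Nat.le_ceil _).trans (by exact_mod_cast hN)
  have hℓ1 : 1 ≤ ℓ := (one_le_pow₀ hl₀).trans hlog
  have hℓ0 : 0 < ℓ := by linarith
  have hq1 : c₃ * (r * ℓ) ≤ n * p := by
    have h1 : c₃ * (μ₀ ^ 2 * r * ℓ / n) ≤ p :=
      (mul_le_mul_of_nonneg_left (le_max_left _ _) hc₃.le).trans hp
    have h2 : c₃ * (r * ℓ / n) ≤ c₃ * (μ₀ ^ 2 * r * ℓ / n) := by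
      have h5 : 1 ≤ μ₀ ^ 2 := one_le_pow₀ hμ₀
      have h3 : (r : ℝ) * ℓ ≤ μ₀ ^ 2 * r * ℓ := by
        have h4 : 0 < (r : ℝ) * ℓ := by positivity
        rw [mul_assoc]
        exact le_mul_of_one_le_left h4.le h5
      gcongr
    have h3 := h2.trans h1
    rw [← mul_div_assoc, div_le_iff₀ hnR] at h3
    linarith
  have hp0 : 0 < p := by
    have h1 : 0 < c₃ * (r * ℓ) := by positivity
    have h2 : 0 < n * p := by linarith
    exact (mul_pos_iff_of_pos_left hnR).mp h2
  have hp1 : p ≤ 1 := ciSup_le fun i => ciSup_le fun j => hP.2.2.1 i j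
  have hq2 : c₃ * ℓ ≤ n * p := by
    refine le_trans ?_ hq1
    have : ℓ ≤ r * ℓ := le_mul_of_one_le_left hℓ0.le hr1'
    gcongr
  -- square roots
  set N := Real.sqrt n with hNdef
  set y := Real.sqrt p with hy
  set R := Real.sqrt r with hR
  set l := Real.sqrt ℓ with hl
  have hN2 : N ^ 2 = n := Real.sq_sqrt hnR.le
  have hy2 : y ^ 2 = p := Real.sq_sqrt hp0.le
  have hR2 : R ^ 2 = r := Real.sq_sqrt (by positivity)
  have hl2 : l ^ 2 = ℓ := Real.sq_sqrt hℓ0.le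
  have hN1 : 1 ≤ N := Real.one_le_sqrt.mpr (by exact_mod_cast hnpos)
  have hy0 : 0 < y := Real.sqrt_pos.mpr hp0
  have hy1 : y ≤ 1 := Real.sqrt_le_one.mpr hp1
  have hR1 : 1 ≤ R := Real.one_le_sqrt.mpr hr1'
  have hll : l₀ ≤ l := Real.le_sqrt_of_sq_le hlog
  have hl1 : 1 ≤ l := hl₀.trans hll
  have hNy : Real.sqrt c₃ * R * l ≤ N * y := by
    rw [hR, hl, hNdef, hy, ← Real.sqrt_mul hc₃.le, ← Real.sqrt_mul (by positivity),
      ← Real.sqrt_mul hnR.le]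
    exact Real.sqrt_le_sqrt (by linarith)
  have hnum' := hnum N y R l μ₀ hN1 hy0 hy1 hR1 hll hμ₀ hNy
  simp only at hnum'
  obtain ⟨hL, hx1, hx2, hx3, hx4, hx5⟩ := hnum'
  have hRpos : 0 < R := by linarith
  have hyl : Real.sqrt (p * ℓ) = y * l := Real.sqrt_mul hp0.le _
  set L := c₁ * N ^ 2 * y ^ 2 / R with hLdef
  have hLl : L ≤ |lam ⟨r - 1, by omega⟩| := by
    rw [hLdef, hN2, hy2]; exact hlamr
  have hlr : |lam ⟨r, hrn⟩| ≤ c₂ * (y * l) := by rw [← hyl]; exact hlamr1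
  have hu : ∀ m, ‖cl (proj V r) (EuclideanSpace.single m 1)‖ ≤ μ₀ * (R / N) := fun m => by
    have := (proj_row V hVlam.1 r hrn.le m).trans hU
    rwa [Real.sqrt_div (by positivity)] at this
  -- the two good events
  have hRS := adj_RS hP hA
  obtain ⟨G, hGm, hGμ, hG⟩ := hRS.spec_tail p c₃ hp0 hp1 hc₃ hℓ1 hnpos hq2
    (fun q m hm => adj_moment hP hA q m hm)
  have hzs : ∀ ω m, (zr m (A ω)).IsSymm := by
    intro ω m
    ext i j
    rw [Matrix.transpose_apply]
    simp only [zr, or_comm, (hA.1 ω).apply]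
  have hex : ∀ B : Matrix (Fin n) (Fin n) ℝ, ∃ Wm : Matrix (Fin n) (Fin n) ℝ × (Fin n → ℝ),
      B.IsSymm → IsEigenDecomp B Wm.1 Wm.2 := by
    intro B
    by_cases hB : B.IsSymm
    · obtain ⟨W, mu, h⟩ := eig_exists B hB
      exact ⟨(W, mu), fun _ => h⟩
    · exact ⟨(1, 0), fun h => absurd h hB⟩
  choose Wm hWm using hex
  obtain ⟨D, hDμ, hD⟩ := row_conc hP hA (fun B => (Wm B).1) (fun ω m => (hWm _ (hzs ω m)).1) r hrn.le
    σ hσ hp0 hℓ0 hnpos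
  have hgood : ∀ ω, ω ∈ G → ω ∉ D →
      ExactRecovery (fun i => rowNorm (Phat ω * centerH n) i) (coreER P) := by
    intro ω hωG hωD
    obtain ⟨W, mu, hWmu, hPh⟩ := hPhat ω
    have hκ : ‖cl (A ω - P)‖ ≤ Real.sqrt K2 * N * y := by
      refine abs_le_of_sq_le_sq' ?_ (by positivity) |>.2
      rw [mul_pow, mul_pow, hN2, hy2, Real.sq_sqrt hK2pos.le]
      have := hG ω hωG
      linarith
    have herr := det_main hVlam hWmu r hr1 hrn (hA.1 ω) (hA.2.1 ω) hPh
      (fun m => (Wm (zr m (A ω))).1) (fun m => (Wm (zr m (A ω))).2)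
      (fun m => hWm _ (hzs ω m)) L _ (N * y ^ 2) _ _ (R * (4 / σ * l ^ 2))
      (R * ((4 / σ + 2 * σ * Real.exp σ) * (y * l))) (24 / (σ * c₁ * Real.sqrt c₃) * (R * l * y))
      hL hκ (fun m => by rw [hy2]; exact prob_row hP m) hLl hlr hu hx1 hx2 (by positivity)
      (by positivity) (by positivity) (fun m => by
        have := hD ω hωD m
        rw [hyl] at this
        refine this.trans (le_of_eq ?_)
        rw [hl2]; ring) hx3 hx4
    refine recov hn hP ?_ (Cp * (μ₀ * R * l * y)) (fun i => (herr i).trans hx5) ?_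
    · rw [hPh, Matrix.IsSymm, Matrix.transpose_mul, Matrix.transpose_mul, Matrix.transpose_transpose,
        Matrix.diagonal_transpose, Matrix.mul_assoc]
    · refine lt_of_lt_of_le ?_ hsignal
      have hX : μ₀ * R * l * y ≤ μ₀ * Real.sqrt (r * (ℓ + r) * p) := by
        have h1 : R * l * y ≤ Real.sqrt (r * (ℓ + r) * p) := by
          rw [hR, hl, hy, ← Real.sqrt_mul (by positivity), ← Real.sqrt_mul (by positivity)]
          refine Real.sqrt_le_sqrt ?_
          have h2 : 0 ≤ (r : ℝ) * r * p := by positivity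
          have h3 : (r : ℝ) * (ℓ + r) * p = r * ℓ * p + r * r * p := by ring
          linarith
        have := mul_le_mul_of_nonneg_left h1 (by linarith : 0 ≤ μ₀)
        linarith
      have hYp : p ≤ μ₀ * R * l * y := by
        rw [← hy2]
        have h1 : 1 ≤ μ₀ * R := one_le_mul_of_one_le_of_one_le hμ₀ hR1
        have h2 : 1 ≤ μ₀ * R * l := one_le_mul_of_one_le_of_one_le h1 hl1
        rw [sq]
        exact mul_le_mul_of_nonneg_right (hy1.trans h2) hy0.le
      have hZ : 0 ≤ μ₀ ^ 2 * r * y := by positivity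
      have hXpos : 0 < μ₀ * R * l * y := by positivity
      have : (2 * Cp + 2) * (μ₀ * R * l * y) ≤ (2 * Cp + 2) *
          (μ₀ * Real.sqrt (r * (ℓ + r) * p) + μ₀ ^ 2 * r * y) := by
        gcongr
        linarith
      linarith
  -- probability bookkeeping
  set ρ := |lam ⟨0, by omega⟩ / lam ⟨r - 1, by omega⟩| with hρ
  have hρ1 : 1 ≤ ρ := by
    rw [hρ, abs_div, one_le_div (by linarith)]
    exact hVlam.2.2 _ _ (Fin.mk_le_mk.mpr (Nat.zero_le _))
  have hB : 10 ≤ Bconst ρ r := by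
    have h1 : 0 ≤ Real.logb 2 ρ := Real.logb_nonneg (by norm_num) hρ1
    have h2 : (1 : ℝ) ≤ min (r : ℝ) (1 + Real.logb 2 ρ) := le_min hr1' (by linarith)
    unfold Bconst; linarith
  have hle : 1 - (Bconst ρ r + 2) * (n : ℝ) ^ (-(1 : ℝ)) ≤ 1 - (μ.real Gᶜ + μ.real D) := by
    rw [Real.rpow_neg_one]
    have h1 : 2 / (n : ℝ) ^ 2 ≤ 2 * (n : ℝ)⁻¹ := by
      rw [div_eq_mul_inv]
      have : (n : ℝ) ≤ (n : ℝ) ^ 2 := by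
        have : (1 : ℝ) ≤ n := by exact_mod_cast hnpos
        exact le_self_pow₀ this (by norm_num)
      gcongr
    have h2 : 12 * (n : ℝ)⁻¹ ≤ (Bconst ρ r + 2) * (n : ℝ)⁻¹ := by
      have : (0 : ℝ) < (n : ℝ)⁻¹ := by positivity
      gcongr; linarith
    have : (0 : ℝ) < (n : ℝ)⁻¹ := by positivity
    linarith
  set S := {ω | ExactRecovery (fun i => rowNorm (Phat ω * centerH n) i) (coreER P)} with hS
  have hcover : (Set.univ : Set Ω) ⊆ S ∪ (Gᶜ ∪ D) := by
    intro ω _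
    by_cases h1 : ω ∈ G
    · by_cases h2 : ω ∈ D
      · exact Or.inr (Or.inr h2)
      · exact Or.inl (hgood ω h1 h2)
    · exact Or.inr (Or.inl h1)
  have hone : 1 ≤ μ.real S + (μ.real Gᶜ + μ.real D) := by
    calc (1 : ℝ) = μ.real Set.univ := by simp
      _ ≤ μ.real (S ∪ (Gᶜ ∪ D)) := measureReal_mono hcover (measure_ne_top _ _)
      _ ≤ μ.real S + μ.real (Gᶜ ∪ D) := measureReal_union_le _ _
      _ ≤ _ := by
          have := measureReal_union_le (μ := μ) Gᶜ D
          linarith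
  refine ENNReal.ofReal_le_of_le_toReal ?_
  change _ ≤ μ.real S
  linarith

end
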